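/- arXiv:1903.01962 — 5 statements merged into one kernel-verified Lean document; each statement's English description precedes it below -/
import Mathlib

section
/- Let x be a real number with x ≥ 2 and n a positive integer with μ(rad(n)) = -1. Then x^{φ(n)} < Φ_n(x) < (x^{q(n)}/(x^{q(n)} - 1)) · x^{φ(n)}. -/
open Polynomial ArithmeticFunction

/-- The radical of a natural number: the product of its distinct prime factors. -/
def rad (n : ℕ) : ℕ := n.primeFactors.prod _root_.id

theorem prod_one_sub_pow_gt {w : ℝ} (hw0 : 0 < w) (hw : w ≤ 1 / 2) {a : ℕ} {A : Finset ℕ}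
    (hA : ∀ d ∈ A, a < d) : 1 - w ^ a < ∏ d ∈ A, (1 - w ^ d) := by
  have hle : ∀ d : ℕ, w ^ d ≤ 1 := fun d => pow_le_one₀ hw0.le (by linarith)
  have key : ∀ k : ℕ, 1 - w ^ a + w ^ (a + k) ≤ ∏ d ∈ Finset.Ioc a (a + k), (1 - w ^ d) := by
    intro k
    induction k with
    | zero => simp
    | succ k ih =>
      rw [← add_assoc, ← Finset.insert_Ioc_right_eq_Ioc_add_one (by omega),
        Finset.prod_insert (by simp)]
      have h1 := hle (a + k + 1)
      have h2 : w ^ (a + k) ≤ w ^ a := pow_le_pow_of_le_one hw0.le (by linarith) (by omega)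
      have h3 : 0 < w ^ (a + k) := by positivity
      have h4 : w ^ (a + k + 1) = w * w ^ (a + k) := pow_succ' _ _
      have h5 : 0 < w ^ (a + k + 1) := by positivity
      nlinarith [mul_le_mul_of_nonneg_left ih (sub_nonneg.2 h1)]
  have hsub : A ⊆ Finset.Ioc a (a + A.sup _root_.id) := fun d hd => by
    have := Finset.le_sup (f := _root_.id) hd
    have := hA d hd
    simp_all only [id_eq, Finset.mem_Ioc, true_and]
    omega
  calc 1 - w ^ a < 1 - w ^ a + w ^ (a + A.sup _root_.id) := by
        have : 0 < w ^ (a + A.sup _root_.id) := by positivity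
        linarith
    _ ≤ _ := key _
    _ ≤ _ := Finset.prod_le_prod_of_subset_of_le_one hsub
        (fun d _ => sub_nonneg.2 (hle d)) (fun d _ _ => by
          have : 0 < w ^ d := by positivity
          linarith)

theorem squarefree_dvd_rad {d n : ℕ} (hn : n ≠ 0) (hd : Squarefree d) (h : d ∣ n) :
    d ∣ rad n := by
  rw [← Nat.prod_primeFactors_of_squarefree hd]
  exact Finset.prod_dvd_prod_of_subset _ _ _ (Nat.primeFactors_mono h hn)

theorem rad_dvd (n : ℕ) : rad n ∣ n := Nat.prod_primeFactors_dvd n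

/-- The Möbius product for `Φ_n(x) / x ^ φ(n)`. -/
theorem cyclotomic_eval_div_pow_totient {x : ℝ} (hx : 1 < x) {n : ℕ} (hn : 0 < n) :
    (cyclotomic n ℝ).eval x / x ^ n.totient =
      ∏ d ∈ n.divisors, (1 - (x ^ (n / d))⁻¹) ^ (moebius d) := by
  have hx0 : x ≠ 0 := by positivity
  have h := (prod_eq_iff_prod_pow_moebius_eq_of_nonzero
    (f := fun m => (cyclotomic m ℝ).eval x / x ^ m.totient)
    (g := fun m => 1 - (x ^ m)⁻¹)
    (fun m _ => div_ne_zero (cyclotomic_pos' m hx).ne' (by positivity))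
    (fun m hm => by
      have : (x ^ m)⁻¹ < 1 := inv_lt_one_of_one_lt₀ (one_lt_pow₀ hx hm.ne')
      linarith)).1 (fun m hm => by
        rw [Finset.prod_div_distrib, Finset.prod_pow_eq_pow_sum, Nat.sum_totient,
          ← eval_prod, prod_cyclotomic_eq_X_pow_sub_one hm]
        simp only [eval_sub, eval_pow, eval_X, eval_one]
        field_simp) n hn
  rw [← h, Nat.prod_divisorsAntidiagonal (f := fun i j => (1 - (x ^ j)⁻¹) ^ (moebius i))]

theorem cyclotomic_eval_div_pow_totient_rad {x : ℝ} (hx : 1 < x) {n : ℕ} (hn : 0 < n) :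
    (cyclotomic n ℝ).eval x / x ^ n.totient =
      ∏ d ∈ (rad n).divisors, (1 - ((x ^ (n / rad n))⁻¹) ^ d) ^ (moebius (rad n / d)) := by
  have hr := rad_dvd n
  have hr0 : rad n ≠ 0 := ne_zero_of_dvd_ne_zero hn.ne' hr
  rw [cyclotomic_eval_div_pow_totient hx hn,
    ← Nat.prod_div_divisors (rad n)
      (fun d => (1 - ((x ^ (n / rad n))⁻¹) ^ d) ^ (moebius (rad n / d))),
    ← Finset.prod_subset (Nat.divisors_subset_of_dvd hn.ne' hr)]
  · refine Finset.prod_congr rfl fun d hd => ?_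
    have hd := Nat.dvd_of_mem_divisors hd
    rw [Nat.div_div_self hd hr0, inv_pow, ← pow_mul, Nat.div_mul_div_comm hr hd,
      mul_comm (rad n) d, Nat.mul_div_mul_right _ _ (Nat.pos_of_ne_zero hr0)]
  · intro d hd hd'
    rw [moebius_eq_zero_of_not_squarefree, zpow_zero]
    intro hsq
    exact hd' (Nat.mem_divisors.2
      ⟨squarefree_dvd_rad hn.ne' hsq (Nat.dvd_of_mem_divisors hd), hr0⟩)

theorem moebius_div_minFac {r : ℕ} (hμ : moebius r = -1) : moebius (r / r.minFac) = 1 := by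
  have hr1 : r ≠ 1 := by rintro rfl; simp at hμ
  have hsq : Squarefree r := moebius_ne_zero_iff_squarefree.1 (by simp [hμ])
  have hmul := Nat.mul_div_cancel' r.minFac_dvd
  have hco : Nat.Coprime r.minFac (r / r.minFac) :=
    Nat.coprime_of_squarefree_mul (by rwa [hmul])
  have h := isMultiplicative_moebius.map_mul_of_coprime hco
  rw [hmul, hμ, moebius_apply_prime (Nat.minFac_prime hr1)] at h
  linarith

theorem prod_one_sub_pow_zpow_bounds {w : ℝ} (hw0 : 0 < w) (hw : w ≤ 1 / 2) {r : ℕ}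
    (hμ : moebius r = -1) :
    1 < ∏ d ∈ r.divisors, (1 - w ^ d) ^ (moebius (r / d)) ∧
      ∏ d ∈ r.divisors, (1 - w ^ d) ^ (moebius (r / d)) < (1 - w)⁻¹ := by
  have hr1 : r ≠ 1 := by rintro rfl; simp at hμ
  have hr0 : r ≠ 0 := by rintro rfl; simp at hμ
  have hp := Nat.minFac_prime hr1
  have hpos : ∀ d : ℕ, d ≠ 0 → 0 < 1 - w ^ d := fun d hd =>
    sub_pos.2 (pow_lt_one₀ hw0.le (by linarith) hd)
  have hle : ∀ d : ℕ, 1 - w ^ d ≤ 1 := fun d => by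
    have : 0 < w ^ d := by positivity
    linarith
  have hdiv0 : ∀ d ∈ r.divisors, d ≠ 0 := fun d hd => (Nat.pos_of_mem_divisors hd).ne'
  have hlo : ∀ d ∈ r.divisors, 1 - w ^ d ≤ (1 - w ^ d) ^ (moebius (r / d)) := fun d hd => by
    conv_lhs => rw [← zpow_one (1 - w ^ d)]
    exact zpow_le_zpow_right_of_le_one₀ (hpos d (hdiv0 d hd)) (hle d)
      (abs_le.1 abs_moebius_le_one).2
  have hup : ∀ d ∈ r.divisors, (1 - w ^ d) ^ (moebius (r / d)) ≤ (1 - w ^ d)⁻¹ := fun d hd => by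
    rw [← zpow_neg_one (1 - w ^ d)]
    exact zpow_le_zpow_right_of_le_one₀ (hpos d (hdiv0 d hd)) (hle d)
      (abs_le.1 abs_moebius_le_one).1
  have h1mem : 1 ∈ r.divisors := Nat.one_mem_divisors.2 hr0
  have hw1 : 0 < 1 - w := by linarith
  rw [← Finset.mul_prod_erase _ _ h1mem, Nat.div_one, hμ, pow_one, zpow_neg_one]
  have hpmem : r.minFac ∈ r.divisors.erase 1 :=
    Finset.mem_erase.2 ⟨hp.ne_one, Nat.mem_divisors.2 ⟨r.minFac_dvd, hr0⟩⟩
  constructor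
  · rw [lt_inv_mul_iff₀ hw1, mul_one]
    calc 1 - w = 1 - w ^ 1 := by rw [pow_one]
      _ < ∏ d ∈ r.divisors.erase 1, (1 - w ^ d) :=
        prod_one_sub_pow_gt hw0 hw fun d hd => by
          have h := Finset.mem_erase.1 hd
          have := hdiv0 d h.2
          omega
      _ ≤ _ := Finset.prod_le_prod
        (fun d hd => (hpos d (hdiv0 d (Finset.mem_of_mem_erase hd))).le)
        (fun d hd => hlo d (Finset.mem_of_mem_erase hd))
  · refine mul_lt_of_lt_one_right (inv_pos.2 hw1) ?_
    rw [← Finset.mul_prod_erase _ _ hpmem, moebius_div_minFac hμ, zpow_one]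
    have hmem : ∀ d ∈ (r.divisors.erase 1).erase r.minFac, d ∈ r.divisors := fun d hd =>
      Finset.mem_of_mem_erase (Finset.mem_of_mem_erase hd)
    have hgt := prod_one_sub_pow_gt hw0 hw (a := r.minFac)
      (A := (r.divisors.erase 1).erase r.minFac) fun d hd => by
        have h := Finset.mem_erase.1 hd
        have h' := Finset.mem_erase.1 h.2
        exact lt_of_le_of_ne (Nat.minFac_le_of_dvd
          (by have := hdiv0 d h'.2; omega) (Nat.dvd_of_mem_divisors h'.2)) h.1.symm
    have hp0 := hpos r.minFac hp.ne_zero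
    calc _ ≤ (1 - w ^ r.minFac) * ∏ d ∈ (r.divisors.erase 1).erase r.minFac, (1 - w ^ d)⁻¹ :=
          mul_le_mul_of_nonneg_left (Finset.prod_le_prod
            (fun d hd => (zpow_pos (hpos d (hdiv0 d (hmem d hd))) _).le)
            (fun d hd => hup d (hmem d hd))) hp0.le
      _ < 1 := by
          rw [Finset.prod_inv_distrib, ← div_eq_mul_inv, div_lt_one (hp0.trans hgt)]
          exact hgt

theorem cyclotomic_bounds_moebius_neg_one (x : ℝ) (hx : 2 ≤ x) (n : ℕ) (hn : 0 < n)
    (hμ : ArithmeticFunction.moebius (rad n) = -1) :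
    x ^ n.totient < (Polynomial.cyclotomic n ℝ).eval x ∧
    (Polynomial.cyclotomic n ℝ).eval x <
      (x ^ (n / rad n) / (x ^ (n / rad n) - 1)) * x ^ n.totient := by
  have hq : n / rad n ≠ 0 := (Nat.div_pos (Nat.le_of_dvd hn (rad_dvd n))
    (Nat.pos_of_dvd_of_pos (rad_dvd n) hn)).ne'
  have hy : 2 ≤ x ^ (n / rad n) := hx.trans (le_self_pow₀ (by linarith) hq)
  have hw : (x ^ (n / rad n))⁻¹ ≤ 1 / 2 := by
    rw [one_div]
    exact inv_anti₀ two_pos hy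
  have h := prod_one_sub_pow_zpow_bounds (by positivity) hw hμ
  have hφ : 0 < x ^ n.totient := by positivity
  rw [← cyclotomic_eval_div_pow_totient_rad (by linarith) hn, one_lt_div hφ, div_lt_iff₀ hφ] at h
  refine ⟨h.1, h.2.trans_eq ?_⟩
  congr 1
  have : x ^ (n / rad n) - 1 ≠ 0 := by linarith
  field_simp
end

section
/- Let x be a real number with x ≥ 2 and n a positive integer. If μ(rad(n)) = 1 then (1/2) x^{φ(n)} ≤ Φ_n(x) < x^{φ(n)}, with equality on the left only when n = 1 and x = 2. If μ(rad(n)) = -1 then x^{φ(n)} < Φ_n(x) < 2 x^{φ(n)}. -/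
open Polynomial ArithmeticFunction

/-- The value of the `n`-th cyclotomic polynomial at `x`, normalized by its leading term. -/
noncomputable def normalizedCyclotomic (n : ℕ) (x : ℝ) : ℝ :=
  (Polynomial.cyclotomic n ℝ).eval x / x ^ n.totient

theorem normalizedCyclotomic_pos (n : ℕ) {x : ℝ} (hx : 1 < x) : 0 < normalizedCyclotomic n x :=
  div_pos (cyclotomic_pos' n hx) (pow_pos (by linarith) _)

theorem normalizedCyclotomic_one {x : ℝ} (hx : x ≠ 0) : normalizedCyclotomic 1 x = 1 - x⁻¹ := by
  simp [normalizedCyclotomic]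
  field_simp

theorem normalizedCyclotomic_prime_mul_of_dvd {p m : ℕ} (hp : p.Prime) (h : p ∣ m) (x : ℝ) :
    normalizedCyclotomic (p * m) x = normalizedCyclotomic m (x ^ p) := by
  unfold normalizedCyclotomic
  rw [Nat.totient_mul_of_prime_of_dvd hp h, mul_comm p m,
    ← cyclotomic_expand_eq_cyclotomic hp h, expand_eval, pow_mul]

theorem normalizedCyclotomic_prime_mul_of_not_dvd {p m : ℕ} (hp : p.Prime) (h : ¬ p ∣ m) {x : ℝ}
    (hx : 1 < x) :
    normalizedCyclotomic (p * m) x = normalizedCyclotomic m (x ^ p) / normalizedCyclotomic m x := by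
  have hpos : 0 < (Polynomial.cyclotomic m ℝ).eval x := cyclotomic_pos' m hx
  have hx0 : x ≠ 0 := by linarith
  have key := congrArg (Polynomial.eval x) (cyclotomic_expand_eq_cyclotomic_mul hp h ℝ)
  rw [expand_eval, eval_mul, mul_comm m p] at key
  have hpow : (x ^ p) ^ m.totient = x ^ ((p - 1) * m.totient) * x ^ m.totient := by
    rw [← pow_mul, ← pow_add, ← Nat.succ_mul, Nat.succ_eq_add_one,
      Nat.sub_add_cancel hp.one_le]
  unfold normalizedCyclotomic
  rw [Nat.totient_mul_of_prime_of_not_dvd hp h, key, hpow]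
  field_simp

/-- The prime divisors of `n` contribute strictly less than the full geometric tail. -/
theorem sum_primeFactors_pow_lt (n : ℕ) {y : ℝ} (hy : 0 < y) (hy2 : y ≤ 1 / 2) :
    ∑ p ∈ n.primeFactors, y ^ p < y := by
  have hle : ∑ p ∈ n.primeFactors, y ^ p ≤ ∑ k ∈ Finset.Ico 2 (n + 2), y ^ k := by
    refine Finset.sum_le_sum_of_subset_of_nonneg (fun p hp => ?_) fun _ _ _ => by positivity
    have h1 := (Nat.prime_of_mem_primeFactors hp).two_le
    have h2 := Nat.le_of_mem_primeFactors hp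
    exact Finset.mem_Ico.2 ⟨h1, by omega⟩
  have hgeom : ∀ k : ℕ, ∑ i ∈ Finset.Ico 2 (k + 2), y ^ i ≤ y - y ^ (k + 1) := by
    intro k
    induction k with
    | zero => simp
    | succ k ih =>
      rw [show k + 1 + 2 = (k + 2) + 1 by ring, Finset.sum_Ico_succ_top (by omega)]
      have h : y ^ (k + 2) = y ^ (k + 1) * y := pow_succ _ _
      have h0 : 0 < y ^ (k + 1) := by positivity
      have : k + 1 + 1 = k + 2 := rfl
      rw [this]
      nlinarith
  have := hgeom n
  have : 0 < y ^ (n + 1) := by positivity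
  linarith

theorem normalizedCyclotomic_zpow_moebius_bounds {n : ℕ} (hn : Squarefree n) :
    ∀ x : ℝ, 2 ≤ x →
      1 - x⁻¹ ≤ normalizedCyclotomic n x ^ moebius n ∧
      (n ≠ 1 → 1 - x⁻¹ < normalizedCyclotomic n x ^ moebius n) ∧
      normalizedCyclotomic n x ^ moebius n ≤
        (1 - x⁻¹) / (1 - ∑ p ∈ n.primeFactors, x⁻¹ ^ p) := by
  induction n using Nat.strong_induction_on with
  | _ n ih =>
    intro x hx
    rcases eq_or_ne n 1 with rfl | hn1
    · simp [normalizedCyclotomic_one (show x ≠ 0 by linarith)]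
    obtain ⟨p, hp, m, rfl⟩ := Nat.exists_prime_and_dvd hn1
    have hcop : p.Coprime m := Nat.coprime_of_squarefree_mul hn
    have hpm : ¬ p ∣ m := (hp.coprime_iff_not_dvd).1 hcop
    have hm : Squarefree m := hn.of_mul_right
    have hm0 : 0 < m := Nat.pos_of_ne_zero hm.ne_zero
    have hlt : m < p * m := by nlinarith [hp.two_le]
    have hxp : x ≤ x ^ p := le_self_pow₀ (by linarith) hp.ne_zero
    obtain ⟨hx1, -, hx3⟩ := ih m hlt hm x hx
    obtain ⟨hxp1, -, hxp3⟩ := ih m hlt hm (x ^ p) (hx.trans hxp)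
    have hmu : moebius (p * m) = - moebius m := by
      rw [isMultiplicative_moebius.map_mul_of_coprime hcop, moebius_apply_prime hp]
      ring
    have hA := normalizedCyclotomic_pos m (show 1 < x by linarith)
    have hB := normalizedCyclotomic_pos m (show 1 < x ^ p by linarith)
    have hG : normalizedCyclotomic (p * m) x ^ moebius (p * m) =
        normalizedCyclotomic m x ^ moebius m / normalizedCyclotomic m (x ^ p) ^ moebius m := by
      rw [normalizedCyclotomic_prime_mul_of_not_dvd hp hpm (by linarith), hmu, zpow_neg, ← inv_zpow,
        inv_div, div_zpow]
    have hsum : ∑ q ∈ (p * m).primeFactors, x⁻¹ ^ q =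
        x⁻¹ ^ p + ∑ q ∈ m.primeFactors, x⁻¹ ^ q := by
      rw [hcop.primeFactors_mul, Finset.sum_union hcop.disjoint_primeFactors, hp.primeFactors,
        Finset.sum_singleton]
    have half : ∀ z : ℝ, 2 ≤ z → 0 < z⁻¹ ∧ z⁻¹ ≤ 1 / 2 := fun z hz =>
      ⟨by positivity, by rw [one_div]; exact inv_anti₀ (by norm_num) hz⟩
    obtain ⟨hy0, hy2⟩ := half x hx
    obtain ⟨hz0, hz2⟩ := half (x ^ p) (hx.trans hxp)
    have hS := sum_primeFactors_pow_lt m hy0 hy2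
    have hSp := sum_primeFactors_pow_lt m hz0 hz2
    have hSn := sum_primeFactors_pow_lt (p * m) hy0 hy2
    have hS0 : 0 ≤ ∑ q ∈ m.primeFactors, x⁻¹ ^ q :=
      Finset.sum_nonneg fun _ _ => by positivity
    rw [hG, hsum]
    rw [hsum] at hSn
    have hlt1 : normalizedCyclotomic m (x ^ p) ^ moebius m < 1 := by
      refine hxp3.trans_lt ?_
      rw [div_lt_one (by linarith)]
      linarith
    have hGx : 0 < normalizedCyclotomic m x ^ moebius m := zpow_pos hA _
    have hGxp : 0 < normalizedCyclotomic m (x ^ p) ^ moebius m := zpow_pos hB _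
    have hstrict : 1 - x⁻¹ <
        normalizedCyclotomic m x ^ moebius m / normalizedCyclotomic m (x ^ p) ^ moebius m := by
      refine hx1.trans_lt ?_
      rw [lt_div_iff₀ hGxp]
      exact mul_lt_of_lt_one_right hGx hlt1
    refine ⟨hstrict.le, fun _ => hstrict, ?_⟩
    rw [← inv_pow] at hxp1 hz0 hz2
    calc _ ≤ (1 - x⁻¹) / (1 - ∑ q ∈ m.primeFactors, x⁻¹ ^ q) / (1 - x⁻¹ ^ p) :=
          div_le_div₀ (div_nonneg (by linarith) (by linarith)) hx3 (by linarith) hxp1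
      _ = (1 - x⁻¹) / ((1 - ∑ q ∈ m.primeFactors, x⁻¹ ^ q) * (1 - x⁻¹ ^ p)) := by
          rw [div_div]
      _ ≤ _ := by
          refine div_le_div_of_nonneg_left (by linarith) (by linarith) ?_
          nlinarith [mul_nonneg hS0 hz0.le]

theorem rad_eq_self_of_squarefree {n : ℕ} (hn : Squarefree n) : rad n = n :=
  Nat.prod_primeFactors_of_squarefree hn

theorem rad_prime_mul_of_dvd {p m : ℕ} (hp : p.Prime) (h : p ∣ m) (hm : m ≠ 0) :
    rad (p * m) = rad m := by
  unfold rad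
  rw [Nat.primeFactors_mul hp.ne_zero hm, hp.primeFactors, Finset.union_eq_right.2]
  simp [hp, h, hm]

theorem normalizedCyclotomic_zpow_moebius_rad_bounds {n : ℕ} (hn : n ≠ 0) :
    ∀ x : ℝ, 2 ≤ x →
      1 - x⁻¹ ≤ normalizedCyclotomic n x ^ moebius (rad n) ∧
      (n ≠ 1 → 1 - x⁻¹ < normalizedCyclotomic n x ^ moebius (rad n)) ∧
      normalizedCyclotomic n x ^ moebius (rad n) < 1 := by
  induction n using Nat.strong_induction_on with
  | _ n ih =>
    intro x hx
    by_cases hsq : Squarefree n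
    · rw [rad_eq_self_of_squarefree hsq]
      obtain ⟨h1, h2, h3⟩ := normalizedCyclotomic_zpow_moebius_bounds hsq x hx
      refine ⟨h1, h2, h3.trans_lt ?_⟩
      have hy0 : 0 < x⁻¹ := by positivity
      have hy2 : x⁻¹ ≤ 1 / 2 := by rw [one_div]; exact inv_anti₀ (by norm_num) hx
      have hS := sum_primeFactors_pow_lt n hy0 hy2
      rw [div_lt_one (by linarith)]
      linarith
    · rw [Nat.squarefree_iff_prime_squarefree] at hsq
      push Not at hsq
      obtain ⟨p, hp, k, rfl⟩ := hsq
      rw [mul_assoc] at hn ih ⊢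
      have hm0 : p * k ≠ 0 := right_ne_zero_of_mul hn
      have hdvd : p ∣ p * k := dvd_mul_right p k
      have hm1 : p * k ≠ 1 := fun h => hp.one_lt.ne' (Nat.eq_one_of_mul_eq_one_right h)
      have hxp : x ≤ x ^ p := le_self_pow₀ (by linarith) hp.ne_zero
      have hlt : p * k < p * (p * k) := by nlinarith [hp.two_le, Nat.pos_of_ne_zero hm0]
      obtain ⟨-, h2, h3⟩ := ih (p * k) hlt hm0 (x ^ p) (hx.trans hxp)
      rw [rad_prime_mul_of_dvd hp hdvd hm0, normalizedCyclotomic_prime_mul_of_dvd hp hdvd]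
      have hinv : (x ^ p)⁻¹ ≤ x⁻¹ := inv_anti₀ (by linarith) hxp
      have := h2 hm1
      exact ⟨by linarith, fun _ => by linarith, h3⟩

theorem cyclotomic_half_two_bounds (x : ℝ) (hx : 2 ≤ x) (n : ℕ) (hn : 0 < n) :
    (ArithmeticFunction.moebius (rad n) = 1 →
      (1 / 2) * x ^ n.totient ≤ (Polynomial.cyclotomic n ℝ).eval x ∧
      (Polynomial.cyclotomic n ℝ).eval x < x ^ n.totient ∧
      ((1 / 2) * x ^ n.totient = (Polynomial.cyclotomic n ℝ).eval x → n = 1 ∧ x = 2)) ∧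
    (ArithmeticFunction.moebius (rad n) = -1 →
      x ^ n.totient < (Polynomial.cyclotomic n ℝ).eval x ∧
      (Polynomial.cyclotomic n ℝ).eval x < 2 * x ^ n.totient) := by
  obtain ⟨h1, h2, h3⟩ := normalizedCyclotomic_zpow_moebius_rad_bounds hn.ne' x hx
  have hpow : 0 < x ^ n.totient := by positivity
  have hA := normalizedCyclotomic_pos n (show 1 < x by linarith)
  have hy2 : x⁻¹ ≤ 1 / 2 := by rw [one_div]; exact inv_anti₀ (by norm_num) hx
  have hΦ : (Polynomial.cyclotomic n ℝ).eval x = normalizedCyclotomic n x * x ^ n.totient := by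
    rw [normalizedCyclotomic, div_mul_cancel₀ _ hpow.ne']
  rw [hΦ]
  refine ⟨fun hmu => ?_, fun hmu => ?_⟩
  · rw [hmu, zpow_one] at h1 h2 h3
    refine ⟨by gcongr; linarith, mul_lt_of_lt_one_left hpow h3, fun heq => ?_⟩
    have hhalf := mul_right_cancel₀ hpow.ne' heq
    refine ⟨by_contra fun hn1 => ?_, ?_⟩
    · linarith [h2 hn1]
    · have hinv : x⁻¹ = 2⁻¹ := by linarith
      exact inv_injective hinv
  · have hn1 : n ≠ 1 := by
      rintro rfl
      simp [rad] at hmu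
    have h2 := h2 hn1
    rw [hmu, zpow_neg_one] at h2 h3
    have hinv := mul_inv_cancel₀ hA.ne'
    refine ⟨?_, ?_⟩
    · have : 1 < normalizedCyclotomic n x := by nlinarith
      exact lt_mul_of_one_lt_left hpow this
    · have : normalizedCyclotomic n x < 2 := by nlinarith
      gcongr
end

section
/- If m and n are distinct positive integers and r is a rational number with r ∉ {-1, 0, 1}, then Φ_m(r) ≠ Φ_n(r), except when r = 2 and {m, n} = {2, 6}. -/
open Polynomial

theorem abs_eval_cyclotomic_eq_prod {n : ℕ} (hn : n ≠ 0) (x : ℝ) :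
    |(cyclotomic n ℝ).eval x| = ∏ ζ ∈ primitiveRoots n ℂ, ‖(x : ℂ) - ζ‖ := by
  have h : (((cyclotomic n ℝ).eval x : ℝ) : ℂ) = (cyclotomic n ℂ).eval (x : ℂ) := by
    rw [← map_cyclotomic n Complex.ofRealHom]
    exact (eval_map_apply (f := Complex.ofRealHom) (p := cyclotomic n ℝ) x).symm
  rw [← Real.norm_eq_abs, ← Complex.norm_real, h,
    cyclotomic_eq_prod_X_sub_primitiveRoots (Complex.isPrimitiveRoot_exp n hn), eval_prod,
    norm_prod]
  simp

theorem norm_of_mem_primitiveRoots {n : ℕ} (hn : n ≠ 0) {ζ : ℂ} (hζ : ζ ∈ primitiveRoots n ℂ) :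
    ‖ζ‖ = 1 :=
  ((mem_primitiveRoots (Nat.pos_of_ne_zero hn)).1 hζ).norm'_eq_one hn

theorem abs_eval_cyclotomic_le {n : ℕ} (hn : n ≠ 0) (x : ℝ) :
    |(cyclotomic n ℝ).eval x| ≤ (|x| + 1) ^ n.totient := by
  rw [abs_eval_cyclotomic_eq_prod hn, ← Complex.card_primitiveRoots, ← Finset.prod_const]
  refine Finset.prod_le_prod (fun _ _ => norm_nonneg _) fun ζ hζ => ?_
  simpa [norm_of_mem_primitiveRoots hn hζ] using norm_sub_le (x : ℂ) ζ

theorem le_abs_eval_cyclotomic {n : ℕ} (hn : n ≠ 0) (x : ℝ) :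
    |(|x| - 1)| ^ n.totient ≤ |(cyclotomic n ℝ).eval x| := by
  rw [abs_eval_cyclotomic_eq_prod hn, ← Complex.card_primitiveRoots, ← Finset.prod_const]
  refine Finset.prod_le_prod (fun _ _ => abs_nonneg _) fun ζ hζ => ?_
  simpa [norm_of_mem_primitiveRoots hn hζ] using abs_norm_sub_norm_le (x : ℂ) ζ

theorem lt_abs_eval_cyclotomic {n : ℕ} (hn : 3 ≤ n) {x : ℝ} (hx : x ≠ 0) (hx1 : |x| ≠ 1) :
    |(|x| - 1)| ^ n.totient < |(cyclotomic n ℝ).eval x| := by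
  have hn0 : n ≠ 0 := by lia
  rw [abs_eval_cyclotomic_eq_prod hn0, ← Complex.card_primitiveRoots, ← Finset.prod_const]
  refine Finset.prod_lt_prod_of_nonempty (fun _ _ => abs_pos.2 (sub_ne_zero.2 hx1))
    (fun ζ hζ => ?_) ⟨_, (mem_primitiveRoots (by lia)).2 (Complex.isPrimitiveRoot_exp n hn0)⟩
  have hp := (mem_primitiveRoots (by lia)).1 hζ
  have h1 : ζ.re * ζ.re + ζ.im * ζ.im = 1 := by
    rw [← Complex.normSq_apply, Complex.normSq_eq_norm_sq, norm_of_mem_primitiveRoots hn0 hζ,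
      one_pow]
  have him : ζ.im ≠ 0 := by
    intro him
    have h2 : ζ ^ 2 = 1 := by
      apply Complex.ext
      · simp only [sq, Complex.mul_re, Complex.one_re]; nlinarith
      · simp [sq, him]
    have := Nat.le_of_dvd two_pos (hp.dvd_of_pow_eq_one 2 h2)
    lia
  have hre : |ζ.re| < 1 := by
    rw [← sq_lt_one_iff_abs_lt_one]
    nlinarith [mul_self_pos.2 him]
  have hxre : x * ζ.re < |x| := by
    calc x * ζ.re ≤ |x * ζ.re| := le_abs_self _
      _ = |x| * |ζ.re| := abs_mul _ _
      _ < |x| * 1 := by gcongr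
      _ = |x| := mul_one _
  refine lt_of_pow_lt_pow_left₀ 2 (norm_nonneg _) ?_
  rw [sq_abs, ← Complex.normSq_eq_norm_sq, Complex.normSq_apply]
  simp only [Complex.sub_re, Complex.sub_im, Complex.ofReal_re, Complex.ofReal_im]
  nlinarith [sq_abs x]

theorem eval_cyclotomic_mul_prime_pow {R : Type*} [CommRing R] {p n : ℕ} (hp : p.Prime)
    (hdvd : p ∣ n) (j : ℕ) (x : R) :
    (cyclotomic (n * p ^ j) R).eval x = (cyclotomic n R).eval (x ^ p ^ j) := by
  induction j generalizing x with
  | zero => simp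
  | succ j ih =>
    rw [pow_succ, ← mul_assoc, ← cyclotomic_expand_eq_cyclotomic hp (hdvd.mul_right _),
      expand_eval, ih, ← pow_mul, mul_comm p]

theorem eval_cyclotomic_two_pow_succ {R : Type*} [CommRing R] (k : ℕ) (x : R) :
    (cyclotomic (2 ^ (k + 1)) R).eval x = x ^ 2 ^ k + 1 := by
  rw [pow_succ', eval_cyclotomic_mul_prime_pow Nat.prime_two dvd_rfl, cyclotomic_two]
  simp

theorem exists_eq_pow_mul_orderOf_of_isRoot_cyclotomic {p : ℕ} [Fact p.Prime] {m : ℕ} (hm : m ≠ 0)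
    {t : ZMod p} (ht : (cyclotomic m (ZMod p)).eval t = 0) :
    ∃ k, m = p ^ k * orderOf t := by
  obtain ⟨k, d, hd, rfl⟩ := Nat.exists_eq_pow_mul_and_not_dvd hm p (Fact.out : p.Prime).ne_one
  have : NeZero (d : ZMod p) := ⟨by rwa [Ne, ZMod.natCast_eq_zero_iff]⟩
  exact ⟨k, by rw [(isRoot_cyclotomic_prime_pow_mul_iff_of_charP.1 ht).eq_orderOf]⟩

theorem eval_cyclotomic_two_pow_ne {a : ℤ} (ha : 2 ≤ |a|) {k l : ℕ} (hlk : l < k) :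
    (cyclotomic (2 ^ k) ℤ).eval a ≠ (cyclotomic (2 ^ l) ℤ).eval a := by
  obtain ⟨k, rfl⟩ := Nat.exists_eq_succ_of_ne_zero (Nat.ne_zero_of_lt hlk)
  rw [Nat.succ_eq_add_one, eval_cyclotomic_two_pow_succ]
  intro h
  cases l with
  | zero =>
    simp only [pow_zero, cyclotomic_one, eval_sub, eval_X, eval_one] at h
    cases k with
    | zero => simp at h; lia
    | succ k =>
      have h1 : a ≤ a ^ 2 ^ (k + 1) := by
        rw [← (even_two.pow_of_ne_zero k.succ_ne_zero).pow_abs]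
        exact (le_abs_self a).trans (le_self_pow₀ (by lia) (by positivity))
      lia
  | succ l =>
    rw [eval_cyclotomic_two_pow_succ, add_left_inj] at h
    have h2 := congrArg abs h
    rw [abs_pow, abs_pow] at h2
    have := Nat.pow_right_injective le_rfl (pow_right_injective₀ (by lia) (by lia) h2)
    lia

theorem eq_two_of_eval_cyclotomic_eq {a : ℤ} (ha : 2 ≤ |a|) {p d k l : ℕ} (hp : p.Prime)
    (hd : d ∣ p - 1) (hlk : l < k)
    (h : (cyclotomic (p ^ k * d) ℤ).eval a = (cyclotomic (p ^ l * d) ℤ).eval a) :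
    a = 2 ∧ p ^ k * d = 6 ∧ p ^ l * d = 2 := by
  rcases hp.eq_two_or_odd' with rfl | hodd
  · obtain rfl : d = 1 := by simpa using hd
    simp only [mul_one] at h
    exact absurd h (eval_cyclotomic_two_pow_ne ha hlk)
  have hp3 : 3 ≤ p := by
    have := hp.two_le
    rcases hodd with ⟨c, rfl⟩
    lia
  have hd0 : d ≠ 0 := by rintro rfl; simp at hd; lia
  have hcast (n : ℕ) : (((cyclotomic n ℤ).eval a : ℤ) : ℝ) = (cyclotomic n ℝ).eval (a : ℝ) := by
    rw [← map_cyclotomic_int n ℝ]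
    exact (eval_intCast_map (Int.castRingHom ℝ) (cyclotomic n ℤ) a).symm
  have hA : (2 : ℝ) ≤ |(a : ℝ)| := by exact_mod_cast ha
  have hA3 : 4 * |(a : ℝ)| ≤ |(a : ℝ)| ^ 3 := by
    nlinarith [mul_nonneg (abs_nonneg (a : ℝ)) (mul_nonneg (sub_nonneg.2 hA) (sub_nonneg.2 hA)),
      mul_nonneg (abs_nonneg (a : ℝ)) (sub_nonneg.2 hA)]
  have h' := congrArg (Int.cast : ℤ → ℝ) h
  rw [hcast, hcast] at h'
  cases l with
  | succ l =>
    exfalso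
    obtain ⟨j, rfl⟩ := Nat.exists_eq_add_of_lt hlk
    have hn0 : p ^ (l + 1) * d ≠ 0 := mul_ne_zero (pow_ne_zero _ hp.ne_zero) hd0
    rw [show p ^ (l + 1 + j + 1) * d = p ^ (l + 1) * d * p ^ (j + 1) by ring,
      eval_cyclotomic_mul_prime_pow hp (by rw [pow_succ', mul_assoc]; exact dvd_mul_right _ _)] at h'
    have h1 := le_abs_eval_cyclotomic hn0 ((a : ℝ) ^ p ^ (j + 1))
    rw [h'] at h1
    have h2 := h1.trans (abs_eval_cyclotomic_le hn0 (a : ℝ))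
    have h3 := le_of_pow_le_pow_left₀ (Nat.totient_pos.2 (by lia)).ne' (by positivity) h2
    have h4 : |(a : ℝ)| ^ 3 ≤ |(a : ℝ)| ^ p ^ (j + 1) :=
      pow_le_pow_right₀ (by linarith) (hp3.trans (Nat.le_self_pow (by lia) p))
    have h5 := (le_abs_self _).trans h3
    rw [abs_pow] at h5
    linarith
  | zero =>
    obtain ⟨k, rfl⟩ := Nat.exists_eq_succ_of_ne_zero (Nat.ne_zero_of_lt hlk)
    have hpd : ¬ p ∣ d := fun hdvd => by
      have := Nat.le_of_dvd (by lia) (hdvd.trans hd)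
      lia
    set y : ℝ := (a : ℝ) ^ p ^ k with hy
    have hexp := congrArg (eval y) (cyclotomic_expand_eq_cyclotomic_mul hp hpd ℝ)
    rw [expand_eval, eval_mul] at hexp
    rw [Nat.succ_eq_add_one, show p ^ (k + 1) * d = d * p * p ^ k by ring,
      eval_cyclotomic_mul_prime_pow hp (dvd_mul_left _ _), pow_zero, one_mul, ← hy] at h'
    rw [h'] at hexp
    have h1 := le_abs_eval_cyclotomic hd0 (y ^ p)
    rw [hexp, abs_mul] at h1
    have h2 := h1.trans (mul_le_mul (abs_eval_cyclotomic_le hd0 (a : ℝ))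
      (abs_eval_cyclotomic_le hd0 y) (abs_nonneg _) (by positivity))
    rw [← mul_pow] at h2
    have h3 := (le_abs_self _).trans
      (le_of_pow_le_pow_left₀ (Nat.totient_pos.2 (by lia)).ne' (by positivity) h2)
    have hYabs : |y| = |(a : ℝ)| ^ p ^ k := abs_pow _ _
    have hAY : |(a : ℝ)| ≤ |y| := by
      rw [hYabs]
      exact le_self_pow₀ (by linarith) (pow_ne_zero _ hp.ne_zero)
    rw [abs_pow] at h3
    have hY3 : |y| ^ 3 ≤ |y| ^ p := pow_le_pow_right₀ (by linarith) hp3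
    have hYlt : |y| < 3 := by
      by_contra! hge
      nlinarith [mul_nonneg (sub_nonneg.2 hge) (sq_nonneg |y|)]
    have hk : k = 0 := by
      by_contra hk
      have : |(a : ℝ)| ^ 3 ≤ |(a : ℝ)| ^ p ^ k :=
        pow_le_pow_right₀ (by linarith) (hp3.trans (Nat.le_self_pow hk p))
      linarith
    subst hk
    have ha2 : |a| = 2 := by
      have : |(a : ℝ)| < 3 := hAY.trans_lt hYlt
      have : |a| < 3 := by exact_mod_cast this
      lia
    have hA2 : |(a : ℝ)| = 2 := by exact_mod_cast ha2
    have hY2 : |y| = 2 := by rw [hYabs, hA2]; norm_num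
    rw [hY2, hA2] at h3
    have hp5 : p < 5 := by
      by_contra! hge
      have : (2 : ℝ) ^ 5 ≤ 2 ^ p := pow_le_pow_right₀ (by norm_num) hge
      norm_num at this h3
      linarith
    obtain rfl : p = 3 := by
      rcases hodd with ⟨c, rfl⟩
      lia
    have hdle := Nat.le_of_dvd (by norm_num) hd
    have hd12 : d = 1 ∨ d = 2 := by lia
    rcases eq_or_eq_neg_of_abs_eq ha2 with rfl | rfl <;> rcases hd12 with rfl | rfl <;>
      simp [cyclotomic_three, cyclotomic_six] at h ⊢

theorem eval_div_eq_zero_of_dvd_eval_scaleRoots_cyclotomic {n : ℕ} {p : ℕ} [Fact p.Prime] {a b : ℤ}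
    (hab : IsCoprime a b) (h : (p : ℤ) ∣ ((cyclotomic n ℤ).scaleRoots b).eval a) :
    (b : ZMod p) ≠ 0 ∧ (cyclotomic n (ZMod p)).eval ((a : ZMod p) / b) = 0 := by
  have hmap : ((((cyclotomic n ℤ).scaleRoots b).eval a : ℤ) : ZMod p) =
      ((cyclotomic n (ZMod p)).scaleRoots (b : ZMod p)).eval (a : ZMod p) := by
    rw [← map_cyclotomic_int n (ZMod p)]
    rw [show (b : ZMod p) = Int.castRingHom (ZMod p) b from rfl,
      ← map_scaleRoots _ _ _ (by simp [(cyclotomic.monic n ℤ).leadingCoeff])]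
    exact (eval_intCast_map (Int.castRingHom (ZMod p)) _ a).symm
  rw [(ZMod.intCast_zmod_eq_zero_iff_dvd _ p).2 h] at hmap
  have hb : (b : ZMod p) ≠ 0 := by
    intro hb
    rw [hb, scaleRoots_zero, (cyclotomic.monic n _).leadingCoeff, one_smul, eval_pow, eval_X] at hmap
    have ha := eq_zero_of_pow_eq_zero hmap.symm
    obtain ⟨u, v, huv⟩ := hab
    have := congrArg (Int.cast : ℤ → ZMod p) huv
    simp [ha, hb] at this
  refine ⟨hb, ?_⟩
  have := scaleRoots_eval_mul (cyclotomic n (ZMod p)) ((a : ZMod p) / b) b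
  rw [mul_div_cancel₀ _ hb, ← hmap] at this
  exact (mul_eq_zero.1 this.symm).resolve_left (pow_ne_zero _ hb)

theorem intCast_eval_scaleRoots_cyclotomic (n : ℕ) (r : ℚ) :
    ((((cyclotomic n ℤ).scaleRoots r.den).eval r.num : ℤ) : ℚ) =
      (r.den : ℚ) ^ n.totient * (cyclotomic n ℚ).eval r := by
  have h := scaleRoots_eval₂_mul (p := cyclotomic n ℤ) (Int.castRingHom ℚ) r (r.den : ℤ)
  rw [natDegree_cyclotomic, eval₂_eq_eval_map (p := cyclotomic n ℤ), map_cyclotomic, eq_intCast,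
    Int.cast_natCast,
    Rat.den_mul_eq_num, ← eq_intCast (Int.castRingHom ℚ) r.num, eval₂_at_apply, eq_intCast] at h
  exact h

theorem isCoprime_eval_scaleRoots_cyclotomic (n : ℕ) (r : ℚ) :
    IsCoprime (r.den : ℤ) (((cyclotomic n ℤ).scaleRoots r.den).eval r.num) := by
  rw [Int.isCoprime_iff_gcd_eq_one]
  refine Nat.coprime_of_dvd fun p hp hb hV => ?_
  have : Fact p.Prime := ⟨hp⟩
  refine (eval_div_eq_zero_of_dvd_eval_scaleRoots_cyclotomic r.isCoprime_num_den
    (Int.natCast_dvd.2 hV)).1 ?_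
  rw [ZMod.intCast_zmod_eq_zero_iff_dvd]
  exact Int.natCast_dvd.2 hb

theorem den_pow_totient_dvd_of_eval_cyclotomic_eq {m n : ℕ} {r : ℚ}
    (h : (cyclotomic m ℚ).eval r = (cyclotomic n ℚ).eval r) :
    r.den ^ m.totient ∣ r.den ^ n.totient := by
  have hV : (r.den : ℤ) ^ m.totient * ((cyclotomic n ℤ).scaleRoots r.den).eval r.num =
      (r.den : ℤ) ^ n.totient * ((cyclotomic m ℤ).scaleRoots r.den).eval r.num := by
    have : (r.den : ℚ) ^ m.totient * (((cyclotomic n ℤ).scaleRoots r.den).eval r.num : ℤ) =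
        (r.den : ℚ) ^ n.totient * (((cyclotomic m ℤ).scaleRoots r.den).eval r.num : ℤ) := by
      rw [intCast_eval_scaleRoots_cyclotomic, intCast_eval_scaleRoots_cyclotomic, h]
      ring
    exact_mod_cast this
  have hd : (r.den : ℤ) ^ m.totient ∣ (r.den : ℤ) ^ n.totient :=
    (isCoprime_eval_scaleRoots_cyclotomic m r).pow_left.dvd_of_dvd_mul_right
      (hV ▸ dvd_mul_right _ _)
  exact_mod_cast hd

theorem one_lt_abs_eval_scaleRoots_cyclotomic {n : ℕ} (hn : 3 ≤ n) {r : ℚ} (hr : r ≠ 0)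
    (hr1 : |r| ≠ 1) : 1 < |((cyclotomic n ℤ).scaleRoots r.den).eval r.num| := by
  have h := lt_abs_eval_cyclotomic hn (x := (r : ℝ)) (by exact_mod_cast hr) (by exact_mod_cast hr1)
  have hcast : (((cyclotomic n ℚ).eval r : ℚ) : ℝ) = (cyclotomic n ℝ).eval (r : ℝ) := by
    rw [← map_cyclotomic n (Rat.castHom ℝ)]
    exact (eval_map_apply (f := Rat.castHom ℝ) (p := cyclotomic n ℚ) r).symm
  rw [← hcast] at h
  have h' : |(|r| - 1)| ^ n.totient < |(cyclotomic n ℚ).eval r| := by exact_mod_cast h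
  have hden : (0 : ℚ) < r.den := by exact_mod_cast r.den_pos
  have hdist : (1 : ℚ) ≤ r.den * |(|r| - 1)| := by
    have e : (r.den : ℚ) * |(|r| - 1)| = ((|(|r.num| - r.den)| : ℤ) : ℚ) := by
      push_cast
      rw [← Rat.den_mul_eq_num r, abs_mul, abs_of_pos hden, ← mul_sub_one, abs_mul,
        abs_of_pos hden]
    have hne : |r| - 1 ≠ 0 := sub_ne_zero.2 hr1
    have hpos : 0 < (r.den : ℚ) * |(|r| - 1)| := by positivity
    rw [e] at hpos ⊢
    exact_mod_cast hpos
  have hfin : (1 : ℚ) < |((((cyclotomic n ℤ).scaleRoots r.den).eval r.num : ℤ) : ℚ)| := by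
    rw [intCast_eval_scaleRoots_cyclotomic, abs_mul, abs_of_pos (pow_pos hden _)]
    calc (1 : ℚ) ≤ (r.den * |(|r| - 1)|) ^ n.totient := one_le_pow₀ hdist
      _ = r.den ^ n.totient * |(|r| - 1)| ^ n.totient := mul_pow _ _ _
      _ < _ := by gcongr
  exact_mod_cast hfin

theorem exists_eq_prime_pow_mul_of_eval_cyclotomic_eq {m n : ℕ} (hm : m ≠ 0) (hn : 3 ≤ n) {r : ℚ}
    (hr : r ≠ 0) (hr1 : |r| ≠ 1)
    (h : (cyclotomic m ℚ).eval r = (cyclotomic n ℚ).eval r) :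
    ∃ p d k l : ℕ, p.Prime ∧ d ∣ p - 1 ∧ m = p ^ k * d ∧ n = p ^ l * d := by
  have hden := Nat.dvd_antisymm (den_pow_totient_dvd_of_eval_cyclotomic_eq h)
    (den_pow_totient_dvd_of_eval_cyclotomic_eq h.symm)
  have hV : ((cyclotomic m ℤ).scaleRoots r.den).eval r.num =
      ((cyclotomic n ℤ).scaleRoots r.den).eval r.num := by
    have : ((((cyclotomic m ℤ).scaleRoots r.den).eval r.num : ℤ) : ℚ) =
        (((cyclotomic n ℤ).scaleRoots r.den).eval r.num : ℤ) := by
      rw [intCast_eval_scaleRoots_cyclotomic, intCast_eval_scaleRoots_cyclotomic, h]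
      exact_mod_cast congrArg (fun t : ℕ => (t : ℚ) * (cyclotomic n ℚ).eval r) hden
    exact_mod_cast this
  have h1 := one_lt_abs_eval_scaleRoots_cyclotomic hn hr hr1
  obtain ⟨p, hp, hpV⟩ := Nat.exists_prime_and_dvd
    (n := (((cyclotomic n ℤ).scaleRoots r.den).eval r.num).natAbs)
    (by rw [Int.abs_eq_natAbs] at h1; lia)
  have : Fact p.Prime := ⟨hp⟩
  have hpV' := Int.natCast_dvd.2 hpV
  have hn0 : n ≠ 0 := by lia
  obtain ⟨-, hn'⟩ := eval_div_eq_zero_of_dvd_eval_scaleRoots_cyclotomic r.isCoprime_num_den hpV'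
  obtain ⟨-, hm'⟩ :=
    eval_div_eq_zero_of_dvd_eval_scaleRoots_cyclotomic r.isCoprime_num_den (hV ▸ hpV')
  obtain ⟨l, hl⟩ := exists_eq_pow_mul_orderOf_of_isRoot_cyclotomic hn0 hn'
  obtain ⟨k, hk⟩ := exists_eq_pow_mul_orderOf_of_isRoot_cyclotomic hm hm'
  refine ⟨p, _, k, l, hp, orderOf_dvd_of_pow_eq_one (ZMod.pow_card_sub_one_eq_one fun h0 => ?_),
    hk, hl⟩
  rw [h0, orderOf_zero, mul_zero] at hl
  exact hn0 hl

theorem eval_cyclotomic_one_ne_eval_cyclotomic_two (r : ℚ) :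
    (cyclotomic 1 ℚ).eval r ≠ (cyclotomic 2 ℚ).eval r := by
  simp only [cyclotomic_one, cyclotomic_two, eval_sub, eval_add, eval_X, eval_one]
  intro h
  linarith

theorem totient_prime_pow_mul_lt {p d k l : ℕ} (hp : p.Prime) (hd : d ∣ p - 1) (hlk : l < k)
    (hk : 3 ≤ p ^ k * d) : (p ^ l * d).totient < (p ^ k * d).totient := by
  have hp2 := hp.two_le
  have hd0 : 0 < d := Nat.pos_of_dvd_of_pos hd (by lia)
  have hcop : p.Coprime d := (hp.coprime_iff_not_dvd).2 fun hdvd => by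
    have := Nat.le_of_dvd (by lia) (hdvd.trans hd)
    lia
  rw [Nat.totient_mul (hcop.pow_left _), Nat.totient_mul (hcop.pow_left _)]
  refine Nat.mul_lt_mul_of_pos_right ?_ (Nat.totient_pos.2 hd0)
  obtain ⟨k, rfl⟩ := Nat.exists_eq_succ_of_ne_zero (Nat.ne_zero_of_lt hlk)
  rw [Nat.succ_eq_add_one, Nat.totient_prime_pow_succ hp]
  cases l with
  | succ l =>
    rw [Nat.totient_prime_pow_succ hp]
    exact Nat.mul_lt_mul_of_pos_right (Nat.pow_lt_pow_right hp.one_lt (by lia)) (by lia)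
  | zero =>
    rw [pow_zero, Nat.totient_one]
    rcases hp2.eq_or_lt with rfl | hp3
    · obtain rfl : d = 1 := by simpa using hd
      have hk0 : k ≠ 0 := by rintro rfl; simp at hk
      simpa using Nat.one_lt_two_pow hk0
    · have := Nat.mul_le_mul (Nat.one_le_pow k p hp.pos) (show 2 ≤ p - 1 by lia)
      lia

theorem eq_two_of_eval_cyclotomic_eq_rat {r : ℚ} (hr : r ≠ 0) (hr1 : |r| ≠ 1) {p d k l : ℕ}
    (hp : p.Prime) (hd : d ∣ p - 1) (hlk : l < k) (hk : 3 ≤ p ^ k * d)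
    (h : (cyclotomic (p ^ k * d) ℚ).eval r = (cyclotomic (p ^ l * d) ℚ).eval r) :
    r = 2 ∧ p ^ k * d = 6 ∧ p ^ l * d = 2 := by
  have hden : r.den = 1 := by
    by_contra hne
    have hlt : 1 < r.den := by have := r.den_pos; lia
    exact (totient_prime_pow_mul_lt hp hd hlk hk).not_ge
      ((Nat.pow_dvd_pow_iff_le_right hlt).1 (den_pow_totient_dvd_of_eval_cyclotomic_eq h))
  obtain ⟨a, rfl⟩ : ∃ a : ℤ, r = a := ⟨r.num, (Rat.coe_int_num_of_den_eq_one hden).symm⟩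
  have hcast (n : ℕ) : (cyclotomic n ℚ).eval (a : ℚ) = ((cyclotomic n ℤ).eval a : ℤ) := by
    rw [← map_cyclotomic_int n ℚ]
    exact eval_intCast_map (Int.castRingHom ℚ) (cyclotomic n ℤ) a
  rw [hcast, hcast, Int.cast_inj] at h
  have h0 : a ≠ 0 := by exact_mod_cast hr
  have h1 : |a| ≠ 1 := by exact_mod_cast hr1
  obtain ⟨rfl, h2⟩ := eq_two_of_eval_cyclotomic_eq (by have := abs_pos.2 h0; lia) hp hd hlk h
  exact ⟨by norm_num, h2⟩

theorem cyclotomic_ne_at_rat (m n : ℕ) (hm : 0 < m) (hn : 0 < n) (hmn : m ≠ n)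
    (r : ℚ) (hr : r ∉ ({-1, 0, 1} : Set ℚ))
    (h : (Polynomial.cyclotomic m ℚ).eval r = (Polynomial.cyclotomic n ℚ).eval r) :
    r = 2 ∧ ({m, n} : Set ℕ) = {2, 6} := by
  simp only [Set.mem_insert_iff, Set.mem_singleton_iff, not_or] at hr
  obtain ⟨hr_neg, hr0, hr_one⟩ := hr
  have hr1 : |r| ≠ 1 := fun h1 => by
    rcases eq_or_eq_neg_of_abs_eq h1 with h2 | h2
    exacts [hr_one h2, hr_neg h2]
  wlog hlt : m < n generalizing m n
  · rw [Set.pair_comm]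
    exact this n m hn hm hmn.symm h.symm (by lia)
  have hn3 : 3 ≤ n := by
    by_contra hcon
    obtain rfl : m = 1 := by lia
    obtain rfl : n = 2 := by lia
    exact eval_cyclotomic_one_ne_eval_cyclotomic_two r h
  obtain ⟨p, d, l, k, hp, hd, rfl, rfl⟩ :=
    exists_eq_prime_pow_mul_of_eval_cyclotomic_eq hm.ne' hn3 hr0 hr1 h
  have hlk : l < k := (Nat.pow_lt_pow_iff_right hp.one_lt).1 (Nat.lt_of_mul_lt_mul_right hlt)
  obtain ⟨h2, hk6, hl2⟩ := eq_two_of_eval_cyclotomic_eq_rat hr0 hr1 hp hd hlk hn3 h.symm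
  exact ⟨h2, by rw [hk6, hl2]⟩
end

section
/- Let m and n be distinct positive integers and let x be a real number with 0 < x ≤ 1/2. Then Φ_m(x) ≠ Φ_n(x). -/
open Polynomial

open Finset ArithmeticFunction ArithmeticFunction.Moebius UniqueFactorizationMonoid

section OneSubPow

variable {y : ℝ}

theorem prod_one_sub_pow_pos (hy0 : 0 < y) (hy1 : y < 1) {S : Finset ℕ} (hS : ∀ d ∈ S, 1 ≤ d) :
    0 < ∏ d ∈ S, (1 - y ^ d) :=
  prod_pos fun d hd => sub_pos.2 (pow_lt_one₀ hy0.le hy1 (by have := hS d hd; omega))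

theorem prod_one_sub_pow_le_of_subset (hy0 : 0 < y) (hy1 : y < 1) {S T : Finset ℕ}
    (hST : S ⊆ T) (hT : ∀ d ∈ T, 1 ≤ d) :
    ∏ d ∈ T, (1 - y ^ d) ≤ ∏ d ∈ S, (1 - y ^ d) := by
  rw [← prod_sdiff hST]
  refine mul_le_of_le_one_left
    (prod_one_sub_pow_pos hy0 hy1 fun d hd => hT d (hST hd)).le (prod_le_one ?_ ?_)
  · intro d _
    exact sub_nonneg.2 (pow_le_one₀ hy0.le hy1.le)
  · intro d _
    have := pow_pos hy0 d
    linarith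

theorem prod_Ico_one_sub_pow_ge (hy0 : 0 < y) (hy1 : y < 1) (k N : ℕ) :
    1 - y - y ^ k + y ^ (k + N) ≤ (1 - y) * ∏ d ∈ Ico k (k + N), (1 - y ^ d) := by
  induction N with
  | zero => simp
  | succ N ih =>
    rw [← add_assoc, prod_Ico_succ_top (by omega), pow_succ]
    have h1 : ∏ d ∈ Ico k (k + N), (1 - y ^ d) ≤ 1 := by
      refine prod_le_one ?_ ?_
      · intro d _
        exact sub_nonneg.2 (pow_le_one₀ hy0.le hy1.le)
      · intro d _
        have := pow_pos hy0 d
        linarith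
    have h2 : 0 < (1 - y) * y ^ (k + N) := mul_pos (sub_pos.2 hy1) (pow_pos hy0 _)
    nlinarith [mul_le_mul_of_nonneg_left h1 h2.le]

theorem lt_prod_one_sub_pow (hy0 : 0 < y) (hy1 : y < 1) {S : Finset ℕ} {k : ℕ} (hk : 1 ≤ k)
    (hS : ∀ d ∈ S, k ≤ d) :
    1 - y - y ^ k < (1 - y) * ∏ d ∈ S, (1 - y ^ d) := by
  have hsub : S ⊆ Ico k (k + (S.sup id + 1)) := by
    intro d hd
    have h : d ≤ S.sup id := le_sup (f := id) hd
    have := hS d hd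
    simp only [mem_Ico]
    omega
  have h1 := prod_one_sub_pow_le_of_subset hy0 hy1 hsub fun d hd =>
    hk.trans (mem_Ico.1 hd).1
  have h2 := prod_Ico_one_sub_pow_ge hy0 hy1 k (S.sup id + 1)
  have h3 := pow_pos hy0 (k + (S.sup id + 1))
  have h4 := mul_le_mul_of_nonneg_left h1 (sub_pos.2 hy1).le
  linarith

theorem one_sub_pow_lt_prod (hy0 : 0 < y) (hy : y ≤ 1 / 2) {S : Finset ℕ} {k : ℕ}
    (hS : ∀ d ∈ S, k + 1 ≤ d) :
    1 - y ^ k < ∏ d ∈ S, (1 - y ^ d) := by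
  have h1 := lt_prod_one_sub_pow hy0 (by linarith) (by omega) hS
  have h2 := pow_pos hy0 k
  rw [pow_succ] at h1
  have h3 : (1 - y) * (1 - y ^ k) < (1 - y) * ∏ d ∈ S, (1 - y ^ d) := by nlinarith
  exact lt_of_mul_lt_mul_left h3 (by linarith)

theorem prod_one_sub_pow_lt_prod (hy0 : 0 < y) (hy : y ≤ 1 / 2) {S T : Finset ℕ}
    (hS : ∀ d ∈ S, 1 ≤ d) {k : ℕ} (hkS : k ∈ S) (hkT : ∀ d ∈ T, k < d) :
    ∏ d ∈ S, (1 - y ^ d) < ∏ d ∈ T, (1 - y ^ d) := by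
  have h1 := prod_one_sub_pow_le_of_subset hy0 (by linarith) (singleton_subset_iff.2 hkS) hS
  rw [prod_singleton] at h1
  exact h1.trans_lt (one_sub_pow_lt_prod hy0 hy hkT)

theorem prod_one_sub_pow_injective (hy0 : 0 < y) (hy : y ≤ 1 / 2) {S T : Finset ℕ}
    (hS : ∀ d ∈ S, 1 ≤ d) (hT : ∀ d ∈ T, 1 ≤ d)
    (h : ∏ d ∈ S, (1 - y ^ d) = ∏ d ∈ T, (1 - y ^ d)) : S = T := by
  have hS' : ∀ d ∈ S \ T, 1 ≤ d := fun d hd => hS d (mem_sdiff.1 hd).1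
  have hT' : ∀ d ∈ T \ S, 1 ≤ d := fun d hd => hT d (mem_sdiff.1 hd).1
  have heq : ∏ d ∈ S \ T, (1 - y ^ d) = ∏ d ∈ T \ S, (1 - y ^ d) := by
    rw [← prod_inter_mul_prod_sdiff S T, ← prod_inter_mul_prod_sdiff T S, inter_comm T S] at h
    exact mul_left_cancel₀ (prod_one_sub_pow_pos hy0 (by linarith)
      fun d hd => hS d (mem_inter.1 hd).1).ne' h
  by_contra hne
  have hex : ∃ k, k ∈ symmDiff S T := by
    by_contra! hcon
    exact hne (symmDiff_eq_bot.1 (eq_empty_of_forall_notMem hcon))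
  classical
  have hk := Nat.find_spec hex
  have hmin : ∀ d ∈ symmDiff S T, Nat.find hex ≤ d := fun d hd => Nat.find_min' hex hd
  set k := Nat.find hex
  rcases mem_symmDiff.1 hk with hk | hk
  · refine (prod_one_sub_pow_lt_prod hy0 hy hS' (mem_sdiff.2 hk) ?_).ne heq
    intro d hd
    refine lt_of_le_of_ne (hmin d (mem_symmDiff.2 (Or.inr (mem_sdiff.1 hd)))) ?_
    rintro rfl
    exact hk.2 (mem_sdiff.1 hd).1
  · refine (prod_one_sub_pow_lt_prod hy0 hy hT' (mem_sdiff.2 hk) ?_).ne' heq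
    intro d hd
    refine lt_of_le_of_ne (hmin d (mem_symmDiff.2 (Or.inl (mem_sdiff.1 hd)))) ?_
    rintro rfl
    exact hk.2 (mem_sdiff.1 hd).1

end OneSubPow

/-- The divisors of `r` at which the Möbius function takes the value `ε`. -/
def moebiusDivisors (ε : ℤ) (r : ℕ) : Finset ℕ := {d ∈ r.divisors | μ d = ε}

/-- For squarefree `r > 1`, this is `Φ_r(y)` or its inverse, according to the sign of `μ r`. -/
noncomputable def moebiusProd (r : ℕ) (y : ℝ) : ℝ := ∏ d ∈ r.divisors, (1 - y ^ d) ^ μ d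

theorem mem_moebiusDivisors {ε : ℤ} {r d : ℕ} :
    d ∈ moebiusDivisors ε r ↔ (d ∣ r ∧ r ≠ 0) ∧ μ d = ε := by
  simp [moebiusDivisors]

theorem one_le_of_mem_moebiusDivisors {ε : ℤ} {r d : ℕ} (hd : d ∈ moebiusDivisors ε r) :
    1 ≤ d :=
  Nat.pos_of_mem_divisors (mem_filter.1 hd).1

theorem two_le_of_mem_moebiusDivisors_neg_one {r d : ℕ} (hd : d ∈ moebiusDivisors (-1) r) :
    2 ≤ d := by
  have h1 := one_le_of_mem_moebiusDivisors hd
  have h2 := (mem_moebiusDivisors.1 hd).2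
  rcases h1.eq_or_lt with rfl | h
  · simp at h2
  · exact h

theorem moebius_four : μ 4 = 0 := by
  have := moebius_apply_prime_pow Nat.prime_two (k := 2) (by norm_num)
  norm_num at this
  exact this

theorem moebius_six : μ 6 = 1 := by
  have := isMultiplicative_moebius.map_mul_of_coprime (m := 2) (n := 3) (by norm_num)
  rw [moebius_apply_prime Nat.prime_two, moebius_apply_prime Nat.prime_three] at this
  norm_num at this
  exact this

theorem mem_moebiusDivisors_neg_one_cases {r d : ℕ} (hd : d ∈ moebiusDivisors (-1) r) :
    d = 2 ∨ d = 3 ∨ d = 5 ∨ 7 ≤ d := by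
  have h1 := two_le_of_mem_moebiusDivisors_neg_one hd
  have h2 := (mem_moebiusDivisors.1 hd).2
  by_contra! hcon
  obtain rfl | rfl : d = 4 ∨ d = 6 := by omega
  · simp [moebius_four] at h2
  · simp [moebius_six] at h2

theorem mem_moebiusDivisors_one_cases {r d : ℕ} (hd : d ∈ moebiusDivisors 1 r) :
    d = 1 ∨ 6 ≤ d := by
  have h1 := one_le_of_mem_moebiusDivisors hd
  have h2 := (mem_moebiusDivisors.1 hd).2
  by_contra! hcon
  obtain rfl | rfl | rfl | rfl : d = 2 ∨ d = 3 ∨ d = 4 ∨ d = 5 := by omega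
  · simp [moebius_apply_prime Nat.prime_two] at h2
  · simp [moebius_apply_prime Nat.prime_three] at h2
  · simp [moebius_four] at h2
  · simp [moebius_apply_prime Nat.prime_five] at h2

theorem moebiusProd_eq_div (r : ℕ) (y : ℝ) :
    moebiusProd r y =
      (∏ d ∈ moebiusDivisors 1 r, (1 - y ^ d)) / ∏ d ∈ moebiusDivisors (-1) r, (1 - y ^ d) := by
  rw [moebiusProd, moebiusDivisors, moebiusDivisors, prod_filter, prod_filter, ← prod_div_distrib]
  refine prod_congr rfl fun d _ => ?_
  rcases moebius_eq_or d with h | h | h <;> simp [h]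

section Bounds

variable {r : ℕ} {y : ℝ}

theorem moebiusProd_pos (hy0 : 0 < y) (hy1 : y < 1) : 0 < moebiusProd r y := by
  rw [moebiusProd_eq_div]
  exact div_pos (prod_one_sub_pow_pos hy0 hy1 fun _ => one_le_of_mem_moebiusDivisors)
    (prod_one_sub_pow_pos hy0 hy1 fun _ => one_le_of_mem_moebiusDivisors)

theorem prod_moebiusDivisors_one_le (hr : r ≠ 0) (hy0 : 0 < y) (hy1 : y < 1) :
    ∏ d ∈ moebiusDivisors 1 r, (1 - y ^ d) ≤ 1 - y := by
  have h := prod_one_sub_pow_le_of_subset hy0 hy1 (S := {1}) (T := moebiusDivisors 1 r)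
    (singleton_subset_iff.2 (mem_moebiusDivisors.2 (by simp [hr])))
    fun _ => one_le_of_mem_moebiusDivisors
  simpa using h

theorem moebiusProd_lt_one (hr : r ≠ 0) (hy0 : 0 < y) (hy : y ≤ 1 / 2) : moebiusProd r y < 1 := by
  have hy1 : y < 1 := by linarith
  rw [moebiusProd_eq_div,
    div_lt_one (prod_one_sub_pow_pos hy0 hy1 fun _ => one_le_of_mem_moebiusDivisors)]
  have h := one_sub_pow_lt_prod hy0 hy (k := 1) fun _ hd =>
    two_le_of_mem_moebiusDivisors_neg_one (r := r) hd
  rw [pow_one] at h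
  exact (prod_moebiusDivisors_one_le hr hy0 hy1).trans_lt h

theorem moebiusProd_mul_le_of_le {B : ℝ} (hr : r ≠ 0) (hy0 : 0 < y) (hy1 : y < 1)
    (hB : B ≤ (1 - y) * ∏ d ∈ moebiusDivisors (-1) r, (1 - y ^ d)) :
    moebiusProd r y * B ≤ (1 - y) ^ 2 := by
  have hN := prod_one_sub_pow_pos hy0 hy1 (S := moebiusDivisors (-1) r)
    fun _ => one_le_of_mem_moebiusDivisors
  refine (mul_le_mul_of_nonneg_left hB (moebiusProd_pos hy0 hy1).le).trans ?_
  have h := prod_moebiusDivisors_one_le hr hy0 hy1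
  rw [moebiusProd_eq_div, mul_left_comm, div_mul_cancel₀ _ hN.ne', sq]
  exact mul_le_mul_of_nonneg_left h (by linarith)

theorem moebiusProd_mul_le (hr : r ≠ 0) (hy0 : 0 < y) (hy1 : y < 1) :
    moebiusProd r y * (1 - y - y ^ 2) ≤ (1 - y) ^ 2 :=
  moebiusProd_mul_le_of_le hr hy0 hy1 (lt_prod_one_sub_pow hy0 hy1 (by norm_num)
    fun _ hd => two_le_of_mem_moebiusDivisors_neg_one hd).le

theorem moebiusProd_mul_le' (hr : r ≠ 0) (hy0 : 0 < y) (hy1 : y < 1) :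
    moebiusProd r y * ((1 - y ^ 2) * (1 - y ^ 3) * ((1 - y) * (1 - y ^ 5) - y ^ 7)) ≤
      (1 - y) ^ 2 := by
  refine moebiusProd_mul_le_of_le hr hy0 hy1 ?_
  have hsub : moebiusDivisors (-1) r ⊆ {2, 3, 5} ∪ {d ∈ moebiusDivisors (-1) r | 7 ≤ d} := by
    intro d hd
    have := mem_moebiusDivisors_neg_one_cases hd
    simp only [mem_union, mem_insert, mem_singleton, mem_filter]
    tauto
  have hdisj : Disjoint ({2, 3, 5} : Finset ℕ) {d ∈ moebiusDivisors (-1) r | 7 ≤ d} := by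
    rw [disjoint_left]
    simp
  have h1 := prod_one_sub_pow_le_of_subset hy0 hy1 hsub (by
    intro d hd
    simp only [mem_union, mem_insert, mem_singleton, mem_filter] at hd
    omega)
  rw [prod_union hdisj] at h1
  have h2 := lt_prod_one_sub_pow hy0 hy1 (S := {d ∈ moebiusDivisors (-1) r | 7 ≤ d}) (k := 7)
    (by norm_num) fun d hd => (mem_filter.1 hd).2
  have h3 : ∏ d ∈ ({2, 3, 5} : Finset ℕ), (1 - y ^ d) =
      (1 - y ^ 2) * (1 - y ^ 3) * (1 - y ^ 5) := by simp [mul_assoc]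
  rw [h3] at h1
  refine le_trans ?_ (mul_le_mul_of_nonneg_left h1 (by linarith))
  have p2 : 0 < 1 - y ^ 2 := sub_pos.2 (pow_lt_one₀ hy0.le hy1 (by norm_num))
  have p3 : 0 < 1 - y ^ 3 := sub_pos.2 (pow_lt_one₀ hy0.le hy1 (by norm_num))
  have p5 : 0 < 1 - y ^ 5 := sub_pos.2 (pow_lt_one₀ hy0.le hy1 (by norm_num))
  have h4 : (1 - y) * (1 - y ^ 5) - y ^ 7 ≤
      (1 - y ^ 5) * ((1 - y) * ∏ d ∈ moebiusDivisors (-1) r with 7 ≤ d, (1 - y ^ d)) := by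
    have h5 := mul_le_mul_of_nonneg_left h2.le p5.le
    have : 0 < y ^ 7 * y ^ 5 := by positivity
    nlinarith
  calc _ ≤ (1 - y ^ 2) * (1 - y ^ 3) * ((1 - y ^ 5) *
        ((1 - y) * ∏ d ∈ moebiusDivisors (-1) r with 7 ≤ d, (1 - y ^ d))) :=
      mul_le_mul_of_nonneg_left h4 (mul_pos p2 p3).le
    _ = _ := by ring

theorem lt_prod_moebiusDivisors_one (hy0 : 0 < y) (hy1 : y < 1) :
    1 - y - y ^ 6 < ∏ d ∈ moebiusDivisors 1 r, (1 - y ^ d) := by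
  have hsub : moebiusDivisors 1 r ⊆ {1} ∪ {d ∈ moebiusDivisors 1 r | 6 ≤ d} := by
    intro d hd
    have := mem_moebiusDivisors_one_cases hd
    simp only [mem_union, mem_singleton, mem_filter]
    tauto
  have hdisj : Disjoint ({1} : Finset ℕ) {d ∈ moebiusDivisors 1 r | 6 ≤ d} := by
    simp
  have h1 := prod_one_sub_pow_le_of_subset hy0 hy1 hsub (by
    intro d hd
    simp only [mem_union, mem_singleton, mem_filter] at hd
    omega)
  rw [prod_union hdisj, prod_singleton, pow_one] at h1
  exact (lt_prod_one_sub_pow hy0 hy1 (by norm_num) fun d hd => (mem_filter.1 hd).2).trans_le h1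

theorem lt_moebiusProd (hy0 : 0 < y) (hy1 : y < 1) : 1 - y - y ^ 6 < moebiusProd r y := by
  refine (lt_prod_moebiusDivisors_one (r := r) hy0 hy1).trans_le ?_
  rw [moebiusProd_eq_div]
  refine le_div_self (prod_one_sub_pow_pos hy0 hy1 fun _ => one_le_of_mem_moebiusDivisors).le
    (prod_one_sub_pow_pos hy0 hy1 fun _ => one_le_of_mem_moebiusDivisors) ?_
  have h := prod_one_sub_pow_le_of_subset hy0 hy1 (empty_subset (moebiusDivisors (-1) r))
    fun _ => one_le_of_mem_moebiusDivisors
  simpa using h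

theorem lt_moebiusProd_mul_of_two_dvd (hr : r ≠ 0) (h2 : 2 ∣ r) (hy0 : 0 < y) (hy1 : y < 1) :
    1 - y - y ^ 6 < moebiusProd r y * (1 - y ^ 2) := by
  have hN := prod_one_sub_pow_pos hy0 hy1 (S := moebiusDivisors (-1) r)
    fun _ => one_le_of_mem_moebiusDivisors
  refine (lt_prod_moebiusDivisors_one (r := r) hy0 hy1).trans_le ?_
  have h := prod_one_sub_pow_le_of_subset hy0 hy1 (S := {2}) (T := moebiusDivisors (-1) r)
    (singleton_subset_iff.2
      (mem_moebiusDivisors.2 ⟨⟨h2, hr⟩, moebius_apply_prime Nat.prime_two⟩))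
    fun _ => one_le_of_mem_moebiusDivisors
  rw [prod_singleton] at h
  refine le_trans (le_of_eq ?_) (mul_le_mul_of_nonneg_left h (moebiusProd_pos hy0 hy1).le)
  rw [moebiusProd_eq_div, div_mul_cancel₀ _ hN.ne']

end Bounds

theorem polynomial_bound_of_le_half {x : ℝ} (hx0 : 0 < x) (hx : x ≤ 1 / 2) :
    (1 - x) ^ 2 * (1 - x ^ 4) <
      (1 - x ^ 2) * (1 - x ^ 3) * ((1 - x) * (1 - x ^ 5) - x ^ 7) * (1 - x ^ 2 - x ^ 12) := by
  have h1 : 0 ≤ x * (1 - 2 * x) * (1 - x) ^ 2 * (1 + x) := by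
    have : 0 ≤ 1 - 2 * x := by linarith
    positivity
  have h2 : x ^ 2 ≤ 1 := pow_le_one₀ hx0.le (by linarith)
  have h9 : x ^ 9 ≤ 1 / 2 := (pow_le_of_le_one hx0.le (by linarith) (by norm_num)).trans hx
  have h3 : 0 < x ^ 11 * ((1 - 2 * x) + x ^ 3 * (2 - x ^ 2 - x ^ 9 + x ^ 10)) := by
    have h10 : 0 < x ^ 10 := by positivity
    have h4 : 0 < 2 - x ^ 2 - x ^ 9 + x ^ 10 := by linarith
    have h5 : 0 ≤ 1 - 2 * x := by linarith
    positivity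
  linear_combination h1 + h3

theorem moebiusProd_pow_lt_of_lt {r q s t : ℕ} (hr : r ≠ 0) (hq : q ≠ 0) (h2 : 2 ∣ t → 2 ∣ q)
    (hs : 1 ≤ s) (hst : s < t) {x : ℝ} (hx0 : 0 < x) (hx : x ≤ 1 / 2) :
    moebiusProd r (x ^ s) < moebiusProd q (x ^ t) := by
  have hx1 : x < 1 := by linarith
  have hz0 : 0 < x ^ t := by positivity
  have hz1 : x ^ t < 1 := pow_lt_one₀ hx0.le hx1 (by omega)
  have hlow := lt_moebiusProd (r := q) hz0 hz1
  rcases hs.eq_or_lt with rfl | hs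
  · have hU := moebiusProd_mul_le' hr hx0 hx1
    have hF := moebiusProd_pos (r := r) hx0 hx1
    have hpoly := polynomial_bound_of_le_half hx0 hx
    rw [pow_one]
    have p2 : 0 < 1 - x ^ 2 := sub_pos.2 (pow_lt_one₀ hx0.le hx1 (by norm_num))
    have p3 : 0 < 1 - x ^ 3 := sub_pos.2 (pow_lt_one₀ hx0.le hx1 (by norm_num))
    have p4 : 0 < 1 - x ^ 4 := sub_pos.2 (pow_lt_one₀ hx0.le hx1 (by norm_num))
    have x2 : x ^ 2 ≤ 1 / 4 := by nlinarith
    have x12 : x ^ 12 ≤ x ^ 2 := pow_le_pow_of_le_one hx0.le hx1.le (by norm_num)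
    have pC : 0 < 1 - x ^ 2 - x ^ 12 := by linarith
    set A := (1 - x ^ 2) * (1 - x ^ 3) * ((1 - x) * (1 - x ^ 5) - x ^ 7)
    have hA : 0 < A := by
      have : 0 < (1 - x) ^ 2 * (1 - x ^ 4) := by
        have : 0 < 1 - x := by linarith
        positivity
      exact pos_of_mul_pos_left (this.trans hpoly) pC.le
    have hup : moebiusProd r x * (1 - x ^ 4) < 1 - x ^ 2 - x ^ 12 := by
      refine lt_of_mul_lt_mul_left (a := A) ?_ hA.le
      calc A * (moebiusProd r x * (1 - x ^ 4)) = moebiusProd r x * A * (1 - x ^ 4) := by ring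
        _ ≤ (1 - x) ^ 2 * (1 - x ^ 4) := mul_le_mul_of_nonneg_right hU p4.le
        _ < _ := hpoly
    refine lt_of_mul_lt_mul_right (hup.trans ?_) p4.le
    obtain rfl | ht : t = 2 ∨ 3 ≤ t := by omega
    · have h := lt_moebiusProd_mul_of_two_dvd hq (h2 dvd_rfl) hz0 hz1
      simpa only [← pow_mul] using h
    · refine lt_of_le_of_lt ?_ (mul_lt_mul_of_pos_right hlow p4)
      have hz : x ^ t ≤ x ^ 3 := pow_le_pow_of_le_one hx0.le hx1.le ht
      have hz6 : (x ^ t) ^ 6 ≤ (x ^ 3) ^ 6 := pow_le_pow_left₀ hz0.le hz 6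
      have h18 : (x ^ 3) ^ 6 ≤ x ^ 5 := by
        rw [← pow_mul]
        exact pow_le_pow_of_le_one hx0.le hx1.le (by norm_num)
      have h3 : x ^ 3 ≤ x ^ 2 / 2 := by nlinarith [pow_pos hx0 2]
      have h4 : x ^ 4 ≤ x ^ 2 / 4 := by nlinarith [pow_pos hx0 2]
      have h5 : x ^ 5 ≤ x ^ 2 / 8 := by nlinarith [pow_pos hx0 2]
      have h12 : 0 < x ^ 12 := by positivity
      have h7 : 0 < x ^ 4 * (x ^ t + (x ^ t) ^ 6) := by positivity
      nlinarith
  · have hy0 : 0 < x ^ s := by positivity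
    have hy4 : x ^ s ≤ 1 / 4 := by
      have h : x ^ s ≤ x ^ 2 := pow_le_pow_of_le_one hx0.le hx1.le hs
      nlinarith
    have hz : x ^ t ≤ x ^ s / 2 := by
      have h : x ^ t ≤ x ^ (s + 1) := pow_le_pow_of_le_one hx0.le hx1.le hst
      rw [pow_succ] at h
      nlinarith
    have hU := moebiusProd_mul_le hr hy0 (by linarith)
    refine lt_trans ?_ hlow
    have hz6 : (x ^ t) ^ 6 ≤ (x ^ t) ^ 2 := pow_le_pow_of_le_one hz0.le hz1.le (by norm_num)
    have hz2 : (x ^ t) ^ 2 ≤ (x ^ s / 2) ^ 2 := pow_le_pow_left₀ hz0.le hz 2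
    generalize x ^ s = y at *
    have hB : 0 < 1 - y - y ^ 2 := by nlinarith
    refine lt_of_lt_of_le (b := 1 - y / 2 - (y / 2) ^ 2) ?_ (by linarith)
    refine lt_of_mul_lt_mul_right (hU.trans_lt ?_) hB.le
    have h3 : 0 < y * (1 - 4 * y) + y ^ 2 / 2 + 3 / 2 * y ^ 3 := by
      have : 0 ≤ 1 - 4 * y := by linarith
      positivity
    have h4 : 0 < y ^ 4 := by positivity
    nlinarith

theorem eq_of_moebiusProd_eq {r q : ℕ} (hr : Squarefree r) (hq : Squarefree q)
    {y : ℝ} (hy0 : 0 < y) (hy : y ≤ 1 / 2) (h : moebiusProd r y = moebiusProd q y) : r = q := by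
  have hy1 : y < 1 := by linarith
  have hdisj (a b : ℕ) : Disjoint (moebiusDivisors 1 a) (moebiusDivisors (-1) b) := by
    rw [disjoint_left]
    intro d h1 h2
    have h1 := (mem_moebiusDivisors.1 h1).2
    have h2 := (mem_moebiusDivisors.1 h2).2
    omega
  have hunion : moebiusDivisors 1 r ∪ moebiusDivisors (-1) q =
      moebiusDivisors 1 q ∪ moebiusDivisors (-1) r := by
    refine prod_one_sub_pow_injective hy0 hy ?_ ?_ ?_
    · intro d hd
      rcases mem_union.1 hd with hd | hd <;> exact one_le_of_mem_moebiusDivisors hd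
    · intro d hd
      rcases mem_union.1 hd with hd | hd <;> exact one_le_of_mem_moebiusDivisors hd
    · rw [prod_union (hdisj _ _), prod_union (hdisj _ _)]
      rw [moebiusProd_eq_div, moebiusProd_eq_div, div_eq_div_iff] at h
      · exact h
      all_goals exact (prod_one_sub_pow_pos hy0 hy1 fun _ => one_le_of_mem_moebiusDivisors).ne'
  have hdvd (d : ℕ) (hd : Squarefree d) : d ∣ r ↔ d ∣ q := by
    have h1 := Finset.ext_iff.1 hunion d
    simp only [mem_union, mem_moebiusDivisors] at h1
    have hr0 := hr.ne_zero
    have hq0 := hq.ne_zero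
    rcases moebius_ne_zero_iff_eq_or.1 (moebius_ne_zero_iff_squarefree.2 hd) with h2 | h2
    · simpa [h2, hr0, hq0] using h1
    · simpa [h2, hr0, hq0, eq_comm, iff_comm] using h1
  exact Nat.dvd_antisymm ((hdvd r hr).1 dvd_rfl) ((hdvd q hq).2 dvd_rfl)

theorem eval_cyclotomic_pos_of_two_le {n : ℕ} (hn : 2 ≤ n) {x : ℝ} (hx0 : 0 < x) :
    0 < (cyclotomic n ℝ).eval x := by
  rcases hn.eq_or_lt with rfl | hn
  · simp only [cyclotomic_two, eval_add, eval_X, eval_one]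
    linarith
  · exact cyclotomic_pos hn x

theorem eval_cyclotomic_eq_prod_divisors {n : ℕ} (hn : 2 ≤ n) {x : ℝ} (hx0 : 0 < x)
    (hx1 : x < 1) :
    (cyclotomic n ℝ).eval x = ∏ e ∈ n.divisors, (1 - x ^ (n / e)) ^ μ e := by
  have hf (k : ℕ) (hk : 0 < k) : (if k = 1 then 1 - x else (cyclotomic k ℝ).eval x) ≠ 0 := by
    split_ifs with h
    · linarith
    · exact (eval_cyclotomic_pos_of_two_le (by omega) hx0).ne'
  have hg (k : ℕ) (hk : 0 < k) : 1 - x ^ k ≠ 0 :=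
    (sub_pos.2 (pow_lt_one₀ hx0.le hx1 hk.ne')).ne'
  have key := (prod_eq_iff_prod_pow_moebius_eq_of_nonzero hf hg).1 (by
    intro k hk
    have h := congrArg (eval x) (prod_cyclotomic_eq_X_pow_sub_one hk ℝ)
    have h1 : 1 ∈ k.divisors := by simp [hk.ne']
    rw [eval_prod, ← mul_prod_erase _ _ h1] at h
    simp only [cyclotomic_one, eval_sub, eval_X, eval_one, eval_pow] at h
    rw [← mul_prod_erase _ _ h1, if_pos rfl]
    have h2 : ∏ i ∈ k.divisors.erase 1, (if i = 1 then 1 - x else (cyclotomic i ℝ).eval x) =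
        ∏ i ∈ k.divisors.erase 1, (cyclotomic i ℝ).eval x :=
      prod_congr rfl fun i hi => if_neg (ne_of_mem_erase hi)
    rw [h2]
    linear_combination -h) n (by omega)
  rw [if_neg (by omega : n ≠ 1)] at key
  rw [← key]
  exact Nat.prod_divisorsAntidiagonal fun i j => (1 - x ^ j) ^ μ i

theorem eval_cyclotomic_eq_moebiusProd_zpow {n : ℕ} (hn : 2 ≤ n) {x : ℝ} (hx0 : 0 < x)
    (hx1 : x < 1) :
    (cyclotomic n ℝ).eval x = moebiusProd (radical n) (x ^ (n / radical n)) ^ μ (radical n) := by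
  have hn0 : n ≠ 0 := by omega
  have hr0 : radical n ≠ 0 := radical_ne_zero
  have hsub : (radical n).divisors ⊆ n.divisors := Nat.divisors_subset_of_dvd hn0 radical_dvd_self
  rw [eval_cyclotomic_eq_prod_divisors hn hx0 hx1, ← prod_subset hsub, moebiusProd,
    ← prod_zpow, ← Nat.prod_div_divisors]
  · refine prod_congr rfl fun d hd => ?_
    obtain ⟨c, hc⟩ := Nat.dvd_of_mem_divisors hd
    have hd0 : 0 < d := Nat.pos_of_mem_divisors hd
    have hc0 : 0 < c := Nat.pos_of_ne_zero (by rintro rfl; simp at hc)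
    obtain ⟨s, hs⟩ : radical n ∣ n := radical_dvd_self
    have hsq : Squarefree (d * c) := hc ▸ squarefree_radical
    have hmu : μ (d * c) = μ d * μ c :=
      isMultiplicative_moebius.map_mul_of_coprime (Nat.coprime_of_squarefree_mul hsq)
    have hd2 : μ d ^ 2 = 1 := moebius_sq_eq_one_of_squarefree hsq.of_mul_left
    have e1 : radical n / d = c := by rw [hc, Nat.mul_div_cancel_left _ hd0]
    have e2 : n / radical n = s := Nat.div_eq_of_eq_mul_right (Nat.pos_of_ne_zero hr0) hs
    have e3 : n / c = s * d := by
      refine Nat.div_eq_of_eq_mul_right hc0 (hs.trans ?_)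
      rw [hc]
      ring
    rw [e1, e2, e3, ← pow_mul, ← zpow_mul, hc, hmu, ← mul_assoc, ← sq, hd2, one_mul]
  · intro e he hne
    have h : μ e = 0 := by
      refine moebius_eq_zero_of_not_squarefree fun hsq => hne ?_
      exact Nat.mem_divisors.2
        ⟨(dvd_radical_iff hsq.isRadical hn0).2 (Nat.dvd_of_mem_divisors he), hr0⟩
    rw [h, zpow_zero]

theorem eval_cyclotomic_ne_of_lt {m n : ℕ} (hm : 0 < m) (hmn : m < n)
    {x : ℝ} (hx0 : 0 < x) (hx : x ≤ 1 / 2) :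
    (cyclotomic m ℝ).eval x ≠ (cyclotomic n ℝ).eval x := by
  have hx1 : x < 1 := by linarith
  rcases (Nat.succ_le_of_lt hm).eq_or_lt with rfl | hm2
  · have h := eval_cyclotomic_pos_of_two_le (by omega : 2 ≤ n) hx0
    refine ne_of_lt (lt_trans ?_ h)
    simp only [Nat.succ_eq_add_one, zero_add, cyclotomic_one, eval_sub, eval_X, eval_one]
    linarith
  have hn2 : 2 ≤ n := by omega
  have hs (k : ℕ) (hk : 2 ≤ k) : 1 ≤ k / radical k :=
    Nat.div_pos (Nat.le_of_dvd (by omega) radical_dvd_self) (Nat.radical_pos k)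
  have hpow (k : ℕ) (hk : 1 ≤ k) : x ^ k ≤ 1 / 2 :=
    (pow_le_of_le_one hx0.le hx1.le (by omega)).trans hx
  have heven (k : ℕ) (hk : 2 ≤ k) (h : 2 ∣ k / radical k) : 2 ∣ radical k :=
    (dvd_radical_iff_of_irreducible Nat.prime_two (by omega)).2
      (h.trans (Nat.div_dvd_of_dvd radical_dvd_self))
  have hne : moebiusProd (radical m) (x ^ (m / radical m)) ≠
      moebiusProd (radical n) (x ^ (n / radical n)) := by
    intro h
    rcases lt_trichotomy (m / radical m) (n / radical n) with hlt | heq | hlt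
    · exact (moebiusProd_pow_lt_of_lt radical_ne_zero radical_ne_zero (heven n hn2)
        (hs m hm2) hlt hx0 hx).ne h
    · rw [heq] at h
      have hrad := eq_of_moebiusProd_eq squarefree_radical squarefree_radical (by positivity)
        (hpow _ (hs n hn2)) h
      have h1 := Nat.div_mul_cancel (radical_dvd_self (a := m))
      have h2 := Nat.div_mul_cancel (radical_dvd_self (a := n))
      rw [heq, hrad, h2] at h1
      omega
    · exact (moebiusProd_pow_lt_of_lt radical_ne_zero radical_ne_zero (heven m hm2)
        (hs n hn2) hlt hx0 hx).ne' h
  have hlt (k : ℕ) (hk : 2 ≤ k) : moebiusProd (radical k) (x ^ (k / radical k)) < 1 :=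
    moebiusProd_lt_one radical_ne_zero (by positivity) (hpow _ (hs k hk))
  have hpos (k : ℕ) (hk : 2 ≤ k) : 0 < moebiusProd (radical k) (x ^ (k / radical k)) :=
    moebiusProd_pos (by positivity) ((hpow _ (hs k hk)).trans_lt (by norm_num))
  have hmu (k : ℕ) : μ (radical k) = 1 ∨ μ (radical k) = -1 :=
    moebius_ne_zero_iff_eq_or.1 (moebius_ne_zero_iff_squarefree.2 squarefree_radical)
  rw [eval_cyclotomic_eq_moebiusProd_zpow hm2 hx0 hx1,
    eval_cyclotomic_eq_moebiusProd_zpow hn2 hx0 hx1]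
  rcases hmu m with h1 | h1 <;> rcases hmu n with h2 | h2 <;>
    simp only [h1, h2, zpow_one, zpow_neg]
  · exact hne
  · exact ((hlt m hm2).trans ((one_lt_inv₀ (hpos n hn2)).2 (hlt n hn2))).ne
  · exact ((hlt n hn2).trans ((one_lt_inv₀ (hpos m hm2)).2 (hlt m hm2))).ne'
  · exact inv_injective.ne hne

theorem cyclotomic_ne_small_real (m n : ℕ) (hm : 0 < m) (hn : 0 < n) (hmn : m ≠ n)
    (x : ℝ) (hx0 : 0 < x) (hx : x ≤ 1 / 2) :
    (Polynomial.cyclotomic m ℝ).eval x ≠ (Polynomial.cyclotomic n ℝ).eval x := by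
  rcases lt_or_gt_of_ne hmn with h | h
  · exact eval_cyclotomic_ne_of_lt hm h hx0 hx
  · exact (eval_cyclotomic_ne_of_lt hn h hx0 hx).symm
end

section
/- Let x be a real number with x ≥ 2 and let m, n be distinct positive integers. Then Φ_m(x) ≠ Φ_n(x), except when x = 2 and {m, n} = {2, 6}. -/
open Polynomial

namespace CyclotomicValues

open ArithmeticFunction UniqueFactorizationMonoid
open scoped ArithmeticFunction.Moebius

/-- The product of the factors `(1 - z ^ d) ^ e d` over `k < d ≤ N`. -/
noncomputable def tailProd (e : ℕ → ℤ) (k N : ℕ) (z : ℝ) : ℝ :=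
  ∏ d ∈ Finset.Ioc k N, (1 - z ^ d) ^ e d

/-- The product of the factors `(1 - z ^ d) ^ μ d` over the divisors `d` of `r`. -/
noncomputable def moebiusProd (r : ℕ) (z : ℝ) : ℝ :=
  ∏ d ∈ r.divisors, (1 - z ^ d) ^ μ d

/-- The Möbius function restricted to the divisors of `r`. -/
def moebiusExp (r d : ℕ) : ℤ := if d ∣ r then μ d else 0

/-- The value at `x` of the `n`-th cyclotomic polynomial, divided by its leading term. -/
noncomputable def normalizedCyclotomic (n : ℕ) (x : ℝ) : ℝ :=
  (cyclotomic n ℝ).eval x / x ^ n.totient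

section Tail

variable {z : ℝ} {e : ℕ → ℤ} {k N : ℕ}

lemma one_sub_pow_pos (h0 : 0 < z) (h1 : z ≤ 1 / 2) {d : ℕ} (hd : d ≠ 0) : 0 < 1 - z ^ d := by
  linarith [pow_lt_one₀ h0.le (by linarith) hd]

lemma one_sub_pow_lt_one (h0 : 0 < z) (d : ℕ) : 1 - z ^ d < 1 := by
  linarith [pow_pos h0 d]

lemma zpow_mem_of_abs_le_one {a : ℝ} (ha : 0 < a) (ha1 : a ≤ 1) {c : ℤ} (hc : |c| ≤ 1) :
    a ≤ a ^ c ∧ a ^ c ≤ a⁻¹ := by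
  have h1 : 1 ≤ a⁻¹ := (one_le_inv₀ ha).2 ha1
  obtain ⟨hc1, hc2⟩ := abs_le.1 hc
  interval_cases c <;> simp [*] <;> linarith

lemma tailProd_pos (h0 : 0 < z) (h1 : z ≤ 1 / 2) : 0 < tailProd e k N z :=
  Finset.prod_pos fun d hd ↦ zpow_pos
    (one_sub_pow_pos h0 h1 (by simp only [Finset.mem_Ioc] at hd; omega)) _

lemma tailProd_neg : tailProd (fun d ↦ -e d) k N z = (tailProd e k N z)⁻¹ := by
  simp [tailProd, zpow_neg]

lemma tailProd_succ (h : k < N) :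
    tailProd e k N z = (1 - z ^ (k + 1)) ^ e (k + 1) * tailProd e (k + 1) N z := by
  unfold tailProd
  rw [← Finset.prod_Ioc_consecutive _ (Nat.le_succ k) h]
  simp

lemma prod_Ioc_one_sub_pow_ge (h0 : 0 < z) (h1 : z ≤ 1 / 2) (h : k ≤ N) :
    1 - z ^ k + z ^ N ≤ ∏ d ∈ Finset.Ioc k N, (1 - z ^ d) := by
  induction N, h using Nat.le_induction with
  | base => simp
  | succ N hN ih =>
    rw [Finset.prod_Ioc_succ_top hN]
    have hz : z ^ N ≤ z ^ k := pow_le_pow_of_le_one h0.le (by linarith) hN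
    have hp : 0 < z ^ N := pow_pos h0 N
    have h2 : z ^ (N + 1) ≤ z ^ N / 2 := by rw [pow_succ]; nlinarith
    have h3 : 0 < z ^ (N + 1) := pow_pos h0 _
    have := mul_le_mul_of_nonneg_right ih (one_sub_pow_pos h0 h1 (d := N + 1) (by omega)).le
    nlinarith

lemma one_sub_pow_lt_tailProd (h0 : 0 < z) (h1 : z ≤ 1 / 2) (he : ∀ d, |e d| ≤ 1) :
    1 - z ^ k < tailProd e k N z := by
  rcases le_or_gt k N with h | h
  · refine lt_of_lt_of_le ?_ ((prod_Ioc_one_sub_pow_ge h0 h1 h).trans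
      (Finset.prod_le_prod (fun d hd ↦ ?_) fun d hd ↦ ?_))
    · linarith [pow_pos h0 N]
    all_goals
      have hd0 : d ≠ 0 := by simp only [Finset.mem_Ioc] at hd; omega
    · exact (one_sub_pow_pos h0 h1 hd0).le
    · exact (zpow_mem_of_abs_le_one (one_sub_pow_pos h0 h1 hd0)
        (one_sub_pow_lt_one h0 d).le (he d)).1
  · rw [tailProd, Finset.Ioc_eq_empty (by omega), Finset.prod_empty]
    exact one_sub_pow_lt_one h0 k

lemma one_sub_pow_mul_tailProd_lt_one (h0 : 0 < z) (h1 : z ≤ 1 / 2) (he : ∀ d, |e d| ≤ 1) :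
    (1 - z ^ k) * tailProd e k N z < 1 := by
  have h := one_sub_pow_lt_tailProd (k := k) (N := N) h0 h1 (e := fun d ↦ -e d) (by simpa using he)
  rw [tailProd_neg] at h
  have hp : 0 < tailProd e k N z := tailProd_pos h0 h1
  calc _ < (tailProd e k N z)⁻¹ * tailProd e k N z := by gcongr
    _ = 1 := inv_mul_cancel₀ hp.ne'

lemma tailProd_lt_one (h0 : 0 < z) (h1 : z ≤ 1 / 2) (he : ∀ d, |e d| ≤ 1) {d₀ : ℕ}
    (hk : k < d₀) (hN : d₀ ≤ N) (hlow : ∀ d, k < d → d < d₀ → e d = 0) (hd₀ : e d₀ = 1) :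
    tailProd e k N z < 1 := by
  obtain ⟨c, rfl⟩ : ∃ c, d₀ = c + 1 := ⟨d₀ - 1, by omega⟩
  have h : tailProd e k N z = tailProd e c N z := by
    unfold tailProd
    rw [← Finset.prod_Ioc_consecutive _ (show k ≤ c by omega) (show c ≤ N by omega),
      Finset.prod_eq_one, one_mul]
    intro d hd
    simp only [Finset.mem_Ioc] at hd
    rw [hlow d (by omega) (by omega), zpow_zero]
  rw [h, tailProd_succ (by omega), hd₀, zpow_one]
  exact one_sub_pow_mul_tailProd_lt_one h0 h1 he

end Tail

section MoebiusProd

variable {z : ℝ} {r s N : ℕ}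

lemma abs_moebiusExp_le_one (r d : ℕ) : |moebiusExp r d| ≤ 1 := by
  unfold moebiusExp
  split_ifs
  · exact abs_moebius_le_one
  · simp

lemma moebiusExp_one : moebiusExp r 1 = 1 := by simp [moebiusExp]

lemma moebiusExp_prime {p : ℕ} (hp : p.Prime) : moebiusExp r p = if p ∣ r then -1 else 0 := by
  simp [moebiusExp, moebius_apply_prime hp]

lemma moebiusExp_four : moebiusExp r 4 = 0 := by
  have : μ 4 = 0 := moebius_eq_zero_of_not_squarefree fun h ↦ by
    simpa using h 2 (by norm_num)
  simp [moebiusExp, this]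

lemma moebiusExp_six : moebiusExp r 6 = if 6 ∣ r then 1 else 0 := by
  have : μ 6 = 1 := by
    rw [show 6 = 2 * 3 from rfl, isMultiplicative_moebius.map_mul_of_coprime (by norm_num),
      moebius_apply_prime Nat.prime_two, moebius_apply_prime Nat.prime_three]
    norm_num
  simp [moebiusExp, this]

lemma moebiusProd_eq_tailProd (hr : r ≠ 0) (hN : r ≤ N) :
    moebiusProd r z = tailProd (moebiusExp r) 0 N z := by
  unfold moebiusProd tailProd
  refine Finset.prod_subset_one_on_sdiff (fun d hd ↦ ?_) (fun d hd ↦ ?_) fun d hd ↦ ?_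
  · have := Nat.divisor_le hd
    have := Nat.pos_of_mem_divisors hd
    simp only [Finset.mem_Ioc]
    omega
  · simp only [Finset.mem_sdiff, Nat.mem_divisors] at hd
    have : ¬ d ∣ r := by tauto
    simp [moebiusExp, this]
  · simp [moebiusExp, Nat.dvd_of_mem_divisors hd]

lemma moebiusProd_pos (h0 : 0 < z) (h1 : z ≤ 1 / 2) : 0 < moebiusProd r z :=
  Finset.prod_pos fun _ hd ↦ zpow_pos
    (one_sub_pow_pos h0 h1 (Nat.pos_of_mem_divisors hd).ne') _

lemma moebiusProd_lt_one (h0 : 0 < z) (h1 : z ≤ 1 / 2) (hr : r ≠ 0) : moebiusProd r z < 1 := by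
  rw [moebiusProd_eq_tailProd hr le_rfl]
  exact tailProd_lt_one h0 h1 (abs_moebiusExp_le_one r) zero_lt_one (by omega)
    (fun _ _ _ ↦ by omega) moebiusExp_one

lemma one_sub_lt_moebiusProd (h0 : 0 < z) (h1 : z ≤ 1 / 2) (hr : 2 ≤ r) :
    1 - z < moebiusProd r z := by
  have hp := Nat.minFac_prime (n := r) (by omega)
  have h : tailProd (fun d ↦ -moebiusExp r d) 1 r z < 1 := by
    refine tailProd_lt_one h0 h1 (fun d ↦ by simpa using abs_moebiusExp_le_one r d) hp.one_lt
      (Nat.minFac_le (by omega)) (fun d hd hd' ↦ ?_) ?_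
    · have : ¬ d ∣ r := fun hdr ↦ absurd (Nat.minFac_le_of_dvd hd hdr) (by omega)
      simp [moebiusExp, this]
    · simp [moebiusExp_prime hp, Nat.minFac_dvd]
  rw [tailProd_neg] at h
  have hpos : 0 < tailProd (moebiusExp r) 1 r z := tailProd_pos h0 h1
  rw [inv_lt_one₀ hpos] at h
  rw [moebiusProd_eq_tailProd (by omega) le_rfl, tailProd_succ (by omega), zero_add,
    moebiusExp_one, zpow_one, pow_one]
  nlinarith

/-- At a fixed point, `moebiusProd` separates squarefree numbers. -/
lemma moebiusProd_ne (h0 : 0 < z) (h1 : z ≤ 1 / 2) (hr : Squarefree r) (hs : Squarefree s)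
    (hrs : r ≠ s) : moebiusProd r z ≠ moebiusProd s z := by
  classical
  have hr0 := hr.ne_zero
  have hs0 := hs.ne_zero
  have hex : ∃ p, ¬ (p ∣ r ↔ p ∣ s) := by
    by_contra! h
    exact hrs (Nat.dvd_antisymm ((h r).1 dvd_rfl) ((h s).2 dvd_rfl))
  obtain ⟨p, hp, hmin⟩ : ∃ p, ¬ (p ∣ r ↔ p ∣ s) ∧ ∀ d < p, (d ∣ r ↔ d ∣ s) :=
    ⟨Nat.find hex, Nat.find_spec hex, fun d hd ↦ not_not.1 (Nat.find_min hex hd)⟩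
  clear hex
  wlog hpr : p ∣ r generalizing r s
  · exact (this hs hr hrs.symm hs0 hr0 (mt Iff.symm hp) (fun d hd ↦ (hmin d hd).symm)
      (by tauto)).symm
  have hps : ¬ p ∣ s := by tauto
  have hp1 : p ≠ 1 := fun h ↦ hps (h ▸ one_dvd s)
  have hp0 : 0 < p := Nat.pos_of_dvd_of_pos hpr (by omega)
  have hprime : p.Prime := by
    by_contra hnp
    obtain ⟨a, b, ha, hb, hab⟩ := (Nat.not_prime_iff_exists_mul_eq (by omega)).1 hnp
    have hsq : Squarefree (a * b) := hab ▸ hr.squarefree_of_dvd hpr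
    have hcop := Nat.coprime_of_squarefree_mul hsq
    refine hps (hab ▸ hcop.mul_dvd_of_dvd_of_dvd ?_ ?_)
    · exact (hmin a ha).1 ((hab ▸ dvd_mul_right a b : a ∣ p).trans hpr)
    · exact (hmin b hb).1 ((hab ▸ dvd_mul_left b a : b ∣ p).trans hpr)
  have hle : p ≤ max r s := (Nat.le_of_dvd (by omega) hpr).trans (le_max_left r s)
  have h : tailProd (fun d ↦ moebiusExp s d - moebiusExp r d) 0 (max r s) z < 1 := by
    refine tailProd_lt_one h0 h1 (fun d ↦ ?_) hp0 hle (fun d _ hd ↦ ?_) ?_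
    · have := abs_moebius_le_one (n := d)
      unfold moebiusExp
      by_cases hdr : d ∣ r <;> by_cases hds : d ∣ s <;> simp [hdr, hds, this]
    · simp [moebiusExp, hmin d hd]
    · simp [moebiusExp_prime hprime, hpr, hps]
  have hdiv : tailProd (fun d ↦ moebiusExp s d - moebiusExp r d) 0 (max r s) z
      = moebiusProd s z / moebiusProd r z := by
    rw [moebiusProd_eq_tailProd hr0 (le_max_left r s),
      moebiusProd_eq_tailProd hs0 (le_max_right r s)]
    unfold tailProd
    rw [← Finset.prod_div_distrib]
    refine Finset.prod_congr rfl fun d hd ↦ zpow_sub₀ (one_sub_pow_pos h0 h1 ?_).ne' _ _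
    simp only [Finset.mem_Ioc] at hd
    omega
  rw [hdiv, div_lt_one (moebiusProd_pos h0 h1)] at h
  exact h.ne'

lemma moebiusProd_mul_le (h0 : 0 < z) (h1 : z ≤ 1 / 2) (hr : r ≠ 0) :
    moebiusProd r z * ((1 - z ^ 2) * (1 - z ^ 3) * (1 - z ^ 5)) ≤ 1 - z := by
  have e2 := moebiusExp_prime (r := r) Nat.prime_two
  have e3 := moebiusExp_prime (r := r) Nat.prime_three
  have p2 := one_sub_pow_pos h0 h1 two_ne_zero
  have p3 := one_sub_pow_pos h0 h1 three_ne_zero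
  have p4 := one_sub_pow_pos h0 h1 four_ne_zero
  have p5 := one_sub_pow_pos h0 h1 (d := 5) (by norm_num)
  have hz1 : 0 < 1 - z := by linarith
  have l2 := one_sub_pow_lt_one h0 2
  have l5 := one_sub_pow_lt_one h0 5
  have h34 : 1 - z ^ 3 ≤ 1 - z ^ 4 := by
    linarith [pow_le_pow_of_le_one h0.le (by linarith) (show 3 ≤ 4 by norm_num)]
  have h23 : 1 - z ^ 2 ≤ 1 - z ^ 3 := by
    linarith [pow_le_pow_of_le_one h0.le (by linarith) (show 2 ≤ 3 by norm_num)]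
  rw [moebiusProd_eq_tailProd (N := r + 6) hr (by omega), tailProd_succ (by omega),
    tailProd_succ (by omega), tailProd_succ (by omega), tailProd_succ (by omega)]
  norm_num only [moebiusExp_one, moebiusExp_four, zpow_zero, zpow_one, pow_one, one_mul]
  by_cases h6 : 6 ∣ r
  · have h2 : 2 ∣ r := (by norm_num : 2 ∣ 6).trans h6
    have h3 : 3 ∣ r := (by norm_num : 3 ∣ 6).trans h6
    rw [tailProd_succ (by omega), tailProd_succ (by omega)]
    norm_num only [moebiusExp_six, e2, e3, h2, h3, h6, if_true, zpow_one, zpow_neg]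
    have hT := one_sub_pow_mul_tailProd_lt_one (k := 6) (N := r + 6) h0 h1
      (abs_moebiusExp_le_one r)
    have h5 := (zpow_mem_of_abs_le_one p5 l5.le (abs_moebiusExp_le_one r 5)).2
    set T := (1 - z ^ 6) * tailProd (moebiusExp r) 6 (r + 6) z
    have hE : (1 - z ^ 5) ^ moebiusExp r 5 * (1 - z ^ 5) ≤ 1 := by
      calc _ ≤ (1 - z ^ 5)⁻¹ * (1 - z ^ 5) := by gcongr
        _ = 1 := inv_mul_cancel₀ p5.ne'
    have hE0 : 0 < (1 - z ^ 5) ^ moebiusExp r 5 * (1 - z ^ 5) := by positivity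
    calc _ = (1 - z) * (((1 - z ^ 5) ^ moebiusExp r 5 * (1 - z ^ 5)) * T) := by
          field_simp
      _ ≤ (1 - z) * 1 := by gcongr; nlinarith
      _ = 1 - z := mul_one _
  · have hT := one_sub_pow_mul_tailProd_lt_one (k := 4) (N := r + 6) h0 h1
      (abs_moebiusExp_le_one r)
    have hT0 : 0 < tailProd (moebiusExp r) 4 (r + 6) z := tailProd_pos h0 h1
    set T := tailProd (moebiusExp r) 4 (r + 6) z
    have key : (1 - z ^ 2) ^ moebiusExp r 2 * (1 - z ^ 3) ^ moebiusExp r 3 *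
        ((1 - z ^ 2) * (1 - z ^ 3)) ≤ 1 - z ^ 4 := by
      have h23' : ¬ (2 ∣ r ∧ 3 ∣ r) := by omega
      by_cases h2 : 2 ∣ r <;> by_cases h3 : 3 ∣ r
      · exact absurd ⟨h2, h3⟩ h23'
      all_goals
        simp only [e2, e3, h2, h3, if_true, if_false, zpow_neg, zpow_one, zpow_zero]
        field_simp
        nlinarith
    calc _ = (1 - z) * (((1 - z ^ 2) ^ moebiusExp r 2 * (1 - z ^ 3) ^ moebiusExp r 3 *
          ((1 - z ^ 2) * (1 - z ^ 3))) * T * (1 - z ^ 5)) := by ring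
      _ ≤ (1 - z) * ((1 - z ^ 4) * T * 1) := by gcongr
      _ ≤ (1 - z) * 1 := by gcongr; linarith
      _ = 1 - z := mul_one _

lemma lt_moebiusProd_of_even (h0 : 0 < z) (h1 : z ≤ 1 / 2) (hr : r ≠ 0) (h2 : 2 ∣ r) :
    (1 - z) * (1 - z ^ 4) < moebiusProd r z * (1 - z ^ 2) := by
  have p2 := one_sub_pow_pos h0 h1 two_ne_zero
  have p3 := one_sub_pow_pos h0 h1 three_ne_zero
  have p4 := one_sub_pow_pos h0 h1 four_ne_zero
  have hz1 : 0 < 1 - z := by linarith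
  have l3 := one_sub_pow_lt_one h0 3
  rw [moebiusProd_eq_tailProd (N := r + 6) hr (by omega), tailProd_succ (by omega),
    tailProd_succ (by omega), tailProd_succ (by omega), tailProd_succ (by omega)]
  norm_num only [moebiusExp_one, moebiusExp_four, zpow_zero, zpow_one, pow_one, one_mul,
    moebiusExp_prime Nat.prime_two, h2, if_true, zpow_neg]
  have hT := one_sub_pow_lt_tailProd (k := 4) (N := r + 6) h0 h1 (abs_moebiusExp_le_one r)
  set T := tailProd (moebiusExp r) 4 (r + 6) z
  have h3 : 1 ≤ (1 - z ^ 3) ^ moebiusExp r 3 := by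
    rw [moebiusExp_prime Nat.prime_three]
    split_ifs
    · rw [zpow_neg, zpow_one]
      exact (one_le_inv₀ p3).2 l3.le
    · simp
  calc (1 - z) * (1 - z ^ 4) < (1 - z) * (1 * T) := by gcongr; linarith
    _ ≤ (1 - z) * ((1 - z ^ 3) ^ moebiusExp r 3 * T) := by gcongr; linarith
    _ = _ := by field_simp

lemma one_le_prod_of_le_half (h0 : 0 < z) (h1 : z ≤ 1 / 2) :
    1 ≤ (1 - z ^ 2) * (1 + z) * (1 - z ^ 3) * ((1 + z ^ 4) * (1 - z ^ 5)) := by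
  have p2 := one_sub_pow_pos h0 h1 two_ne_zero
  have p3 := one_sub_pow_pos h0 h1 three_ne_zero
  have a3 := pow_pos h0 3
  have a4 := pow_pos h0 4
  have q2 : z ^ 2 ≤ 1 / 4 := by nlinarith
  have q3 : z ^ 3 ≤ 1 / 8 := by nlinarith
  have q5 : z ^ 5 ≤ z ^ 4 / 2 := by nlinarith
  have q5' : z ^ 5 ≤ 1 / 32 := by nlinarith
  have h45 : 1 + 15 / 32 * z ^ 4 ≤ (1 + z ^ 4) * (1 - z ^ 5) := by nlinarith
  have hA : 14 / 15 ≤ (1 - z ^ 2) * (1 + z) * (1 - z ^ 3) := by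
    have : 1 + z / 4 ≤ (1 - z ^ 2) * (1 + z) := by nlinarith
    have : (1 + z / 4) * (1 - z ^ 3) ≤ (1 - z ^ 2) * (1 + z) * (1 - z ^ 3) := by gcongr
    nlinarith
  have hg : 0 ≤ z * ((1 - 2 * z) * (1 + z - z ^ 3 * (z + 3 / 2) / 2) + 3 / 16 * z ^ 3) := by
    have : 0 ≤ 1 + z - z ^ 3 * (z + 3 / 2) / 2 := by nlinarith
    have : 0 ≤ 1 - 2 * z := by linarith
    positivity
  calc 1 ≤ (1 - z ^ 2) * (1 + z) * (1 - z ^ 3) * (1 + 15 / 32 * z ^ 4) := by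
        linarith [mul_le_mul_of_nonneg_right hA a4.le]
    _ ≤ _ := by gcongr

/-- Passing from the exponent `q` to a larger exponent `q'` increases `moebiusProd`. -/
lemma moebiusProd_pow_lt {q q' : ℕ} (h0 : 0 < z) (h1 : z ≤ 1 / 2) (hq : 0 < q) (hqq' : q < q')
    (hr : r ≠ 0) (hs : 2 ≤ s) (h2 : q' = 2 → 2 ∣ s) :
    moebiusProd r (z ^ q) < moebiusProd s (z ^ q') := by
  have hz1 : z ≤ 1 := by linarith
  have hhalf : ∀ j : ℕ, 0 < j → z ^ j ≤ 1 / 2 := fun j hj ↦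
    (pow_le_of_le_one h0.le hz1 hj.ne').trans h1
  have hw0 : 0 < z ^ q := pow_pos h0 q
  have hv0 : 0 < z ^ q' := pow_pos h0 q'
  have hU := moebiusProd_mul_le hw0 (hhalf q hq) hr
  have hL := one_sub_lt_moebiusProd hv0 (hhalf q' (by omega)) hs
  set R := moebiusProd r (z ^ q)
  rcases Nat.lt_or_ge 1 q with hq2 | hq1
  · have hw : z ^ q ≤ 1 / 4 := by
      calc z ^ q ≤ z ^ 2 := pow_le_pow_of_le_one h0.le hz1 hq2
        _ ≤ 1 / 4 := by nlinarith
    have hv : z ^ q' ≤ z ^ q / 2 := by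
      calc z ^ q' ≤ z ^ (q + 1) := pow_le_pow_of_le_one h0.le hz1 hqq'
        _ ≤ z ^ q / 2 := by rw [pow_succ]; nlinarith
    refine lt_of_le_of_lt ?_ hL
    generalize z ^ q = w at *
    suffices R ≤ 1 - w / 2 by linarith
    have h2w : w ^ 2 ≤ w / 4 := by nlinarith
    have h3w : w ^ 3 ≤ w / 16 := by rw [pow_succ]; nlinarith
    have h5w : w ^ 5 ≤ w / 256 := by
      rw [show w ^ 5 = w ^ 3 * w ^ 2 by ring]; nlinarith [pow_pos hw0 3, pow_pos hw0 2]
    have hD : 1 - w * (5 / 16 + 1 / 256) ≤ (1 - w ^ 2) * (1 - w ^ 3) * (1 - w ^ 5) := by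
      have a2 := pow_pos hw0 2
      have a3 := pow_pos hw0 3
      have a5 := pow_pos hw0 5
      have : 1 - w ^ 2 - w ^ 3 ≤ (1 - w ^ 2) * (1 - w ^ 3) := by nlinarith
      have : (1 - w ^ 2 - w ^ 3) * (1 - w ^ 5) ≤ (1 - w ^ 2) * (1 - w ^ 3) * (1 - w ^ 5) := by
        gcongr; nlinarith
      nlinarith
    by_contra! hR
    have : (1 - w / 2) * (1 - w * (5 / 16 + 1 / 256)) <
        R * ((1 - w ^ 2) * (1 - w ^ 3) * (1 - w ^ 5)) := by
      apply mul_lt_mul hR hD <;> nlinarith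
    nlinarith
  · obtain rfl : q = 1 := by omega
    rw [pow_one] at hU
    have p2 := one_sub_pow_pos h0 h1 two_ne_zero
    have p3 := one_sub_pow_pos h0 h1 three_ne_zero
    have p5 := one_sub_pow_pos h0 h1 (d := 5) (by norm_num)
    have q2 : z ^ 2 ≤ 1 / 4 := by nlinarith
    have q3 : z ^ 3 ≤ 1 / 8 := by nlinarith
    rcases Nat.lt_or_ge 2 q' with hq3 | hq2
    · have hv : z ^ q' ≤ z ^ 3 := pow_le_pow_of_le_one h0.le hz1 hq3
      refine lt_of_le_of_lt ?_ (lt_of_le_of_lt (by linarith : 1 - z ^ 3 ≤ 1 - z ^ q') hL)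
      by_contra! hR
      have : (1 - z ^ 3) * ((1 - z ^ 2) * (1 - z ^ 3) * (1 - z ^ 5)) <
          R * ((1 - z ^ 2) * (1 - z ^ 3) * (1 - z ^ 5)) := by gcongr
      have hsq : 1 - 2 * z ^ 3 ≤ (1 - z ^ 3) ^ 2 := by nlinarith [sq_nonneg (z ^ 3)]
      have h4 : z ^ 4 ≤ 1 / 16 := by nlinarith
      have h5 : z ^ 5 ≤ 1 / 32 := by nlinarith
      have h1' : 1 ≤ (1 + z) * ((1 - 2 * z ^ 3) * (1 - z ^ 5)) := by
        have : 1 - 2 * z ^ 3 - z ^ 5 ≤ (1 - 2 * z ^ 3) * (1 - z ^ 5) := by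
          nlinarith [pow_pos h0 3, pow_pos h0 5, mul_pos (pow_pos h0 3) (pow_pos h0 5)]
        nlinarith
      have h2' : (1 + z) * ((1 - 2 * z ^ 3) * (1 - z ^ 5)) ≤
          (1 + z) * ((1 - z ^ 3) ^ 2 * (1 - z ^ 5)) := by gcongr
      nlinarith
    · obtain rfl : q' = 2 := by omega
      have hE := lt_moebiusProd_of_even hv0 (hhalf 2 two_pos) (by omega) (h2 rfl)
      set S := moebiusProd s (z ^ 2)
      by_contra! hSR
      have h8 : (1 - z ^ 2) * (1 + z ^ 4) < S := by
        have p4 := one_sub_pow_pos h0 h1 four_ne_zero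
        by_contra! h
        nlinarith [mul_le_mul_of_nonneg_right h p4.le]
      have hlt : (1 - z ^ 2) * (1 + z ^ 4) * ((1 - z ^ 2) * (1 - z ^ 3) * (1 - z ^ 5)) <
          R * ((1 - z ^ 2) * (1 - z ^ 3) * (1 - z ^ 5)) := by
        gcongr
        exact h8.trans_le hSR
      have hone := one_le_prod_of_le_half h0 h1
      have := mul_le_mul_of_nonneg_left hone (by linarith : 0 ≤ 1 - z)
      nlinarith

end MoebiusProd

section Cyclotomic

variable {x : ℝ} {m n : ℕ}

lemma normalizedCyclotomic_pos (hx : 2 ≤ x) (n : ℕ) : 0 < normalizedCyclotomic n x :=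
  div_pos (cyclotomic_pos' n (by linarith)) (by positivity)

lemma prod_normalizedCyclotomic (hx : 2 ≤ x) (hn : 0 < n) :
    ∏ d ∈ n.divisors, normalizedCyclotomic d x = 1 - x⁻¹ ^ n := by
  have hx0 : x ^ n ≠ 0 := by positivity
  unfold normalizedCyclotomic
  rw [Finset.prod_div_distrib, Finset.prod_pow_eq_pow_sum, Nat.sum_totient, ← eval_prod,
    prod_cyclotomic_eq_X_pow_sub_one hn, inv_pow]
  simp only [eval_sub, eval_pow, eval_X, eval_one]
  field_simp

lemma normalizedCyclotomic_eq (hx : 2 ≤ x) (hn : 0 < n) :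
    normalizedCyclotomic n x = moebiusProd (radical n) (x⁻¹ ^ (n / radical n)) ^ μ (radical n) := by
  have h0 : 0 < x⁻¹ := by positivity
  have h1 : x⁻¹ ≤ 1 / 2 := by rw [one_div]; gcongr
  have hinv := (prod_eq_iff_prod_pow_moebius_eq_of_nonzero
    (f := fun n ↦ normalizedCyclotomic n x) (g := fun n ↦ 1 - x⁻¹ ^ n)
    (fun k _ ↦ (normalizedCyclotomic_pos hx k).ne')
    (fun k hk ↦ (one_sub_pow_pos h0 h1 hk.ne').ne')).1
    (fun k hk ↦ prod_normalizedCyclotomic hx hk) n hn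
  have hr0 : radical n ≠ 0 := radical_ne_zero
  have hrn : radical n ∣ n := radical_dvd_self
  have hsq : Squarefree (radical n) := squarefree_radical
  rw [← hinv, Nat.prod_divisorsAntidiagonal (fun a b ↦ (1 - x⁻¹ ^ b) ^ μ a),
    ← Finset.prod_subset (Nat.divisors_subset_of_dvd hn.ne' hrn), moebiusProd,
    ← Finset.prod_zpow, ← Nat.prod_div_divisors (radical n)]
  · refine Finset.prod_congr rfl fun a ha ↦ ?_
    obtain ⟨c, hc⟩ := Nat.dvd_of_mem_divisors ha
    have hc0 : 0 < c := Nat.pos_of_ne_zero fun h ↦ hr0 (by rw [hc, h, mul_zero])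
    have hac : Squarefree (a * c) := hc ▸ hsq
    have hdc : radical n / a = c := by
      rw [hc]; exact Nat.mul_div_cancel_left c (Nat.pos_of_mem_divisors ha)
    have hnc : n / c = n / radical n * a := by
      refine Nat.div_eq_of_eq_mul_left hc0 ?_
      rw [mul_assoc, ← hc, Nat.div_mul_cancel hrn]
    have hμ : μ (radical n) = μ a * μ c := by
      rw [hc, isMultiplicative_moebius.map_mul_of_coprime (Nat.coprime_of_squarefree_mul hac)]
    have hμa := moebius_sq_eq_one_of_squarefree (hac.squarefree_of_dvd (dvd_mul_right a c))
    rw [hdc, hnc, ← pow_mul, ← zpow_mul, hμ]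
    congr 1
    linear_combination (-μ c) * hμa
  · intro a ha ha'
    have : ¬ Squarefree a := fun h ↦ ha' (Nat.mem_divisors.2
      ⟨(dvd_radical_iff h.isRadical hn.ne').2 (Nat.dvd_of_mem_divisors ha), hr0⟩)
    rw [moebius_eq_zero_of_not_squarefree this, zpow_zero]

/-- The normalized value is a `moebiusProd` over the radical, up to inversion. -/
lemma normalizedCyclotomic_cases (hx : 2 ≤ x) (hn : 0 < n) :
    normalizedCyclotomic n x = moebiusProd (radical n) (x⁻¹ ^ (n / radical n)) ∨
      normalizedCyclotomic n x = (moebiusProd (radical n) (x⁻¹ ^ (n / radical n)))⁻¹ := by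
  rw [normalizedCyclotomic_eq hx hn]
  rcases moebius_ne_zero_iff_eq_or.1 (moebius_ne_zero_iff_squarefree.2
    (squarefree_radical (a := n))) with h | h <;> simp [h]

lemma inv_pow_div_radical_mem (hx : 2 ≤ x) (hn : 0 < n) :
    0 < x⁻¹ ^ (n / radical n) ∧ x⁻¹ ^ (n / radical n) ≤ 1 / 2 := by
  have h0 : 0 < x⁻¹ := by positivity
  have h1 : x⁻¹ ≤ 1 / 2 := by rw [one_div]; gcongr
  have hq : n / radical n ≠ 0 :=
    (Nat.div_pos (Nat.le_of_dvd hn radical_dvd_self) (Nat.radical_pos n)).ne'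
  exact ⟨pow_pos h0 _, (pow_le_of_le_one h0.le (by linarith) hq).trans h1⟩

lemma normalizedCyclotomic_mem_Ioo (hx : 2 ≤ x) (hn : 2 ≤ n) :
    normalizedCyclotomic n x ∈ Set.Ioo (1 / 2 : ℝ) 2 := by
  obtain ⟨hz0, hz1⟩ := inv_pow_div_radical_mem hx (n := n) (by omega)
  have hlt := moebiusProd_lt_one hz0 hz1 (r := radical n) radical_ne_zero
  have hgt := one_sub_lt_moebiusProd hz0 hz1 (Nat.two_le_radical_iff.2 hn)
  have hpos := moebiusProd_pos (r := radical n) hz0 hz1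
  rcases normalizedCyclotomic_cases hx (n := n) (by omega) with h | h <;> rw [h]
  · constructor <;> linarith
  · constructor
    · have := (one_lt_inv₀ hpos).2 hlt
      linarith
    · rw [inv_lt_comm₀ hpos two_pos, ← one_div]
      linarith

lemma normalizedCyclotomic_ne (hx : 2 ≤ x) (hm : 2 ≤ m) (hn : 2 ≤ n) (hmn : m ≠ n) :
    normalizedCyclotomic m x ≠ normalizedCyclotomic n x := by
  have h0 : 0 < x⁻¹ := by positivity
  have h1 : x⁻¹ ≤ 1 / 2 := by rw [one_div]; gcongr
  intro h
  wlog hq : m / radical m ≤ n / radical n generalizing m n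
  · exact this hn hm hmn.symm h.symm (by omega)
  obtain ⟨hz0, hz1⟩ := inv_pow_div_radical_mem hx (n := m) (by omega)
  obtain ⟨hw0, hw1⟩ := inv_pow_div_radical_mem hx (n := n) (by omega)
  have hR1 := moebiusProd_lt_one hz0 hz1 (r := radical m) radical_ne_zero
  have hS1 := moebiusProd_lt_one hw0 hw1 (r := radical n) radical_ne_zero
  have hR0 := moebiusProd_pos (r := radical m) hz0 hz1
  have hS0 := moebiusProd_pos (r := radical n) hw0 hw1
  have hRS : moebiusProd (radical m) (x⁻¹ ^ (m / radical m)) =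
      moebiusProd (radical n) (x⁻¹ ^ (n / radical n)) := by
    have hR1' := (one_lt_inv₀ hR0).2 hR1
    have hS1' := (one_lt_inv₀ hS0).2 hS1
    rcases normalizedCyclotomic_cases hx (n := m) (by omega) with hm' | hm' <;>
    rcases normalizedCyclotomic_cases hx (n := n) (by omega) with hn' | hn' <;>
    rw [hm', hn'] at h
    · exact h
    · linarith
    · linarith
    · exact inv_injective h
  rcases hq.lt_or_eq with hq | hq
  · refine (moebiusProd_pow_lt h0 h1 ?_ hq radical_ne_zero (Nat.two_le_radical_iff.2 hn) ?_).ne hRS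
    · exact Nat.div_pos (Nat.le_of_dvd (by omega) radical_dvd_self) (Nat.radical_pos m)
    · intro h2
      have : n / radical n ∣ n := Nat.div_dvd_of_dvd radical_dvd_self
      rw [h2] at this
      exact (dvd_radical_iff Nat.prime_two.prime.isRadical (by omega)).2 this
  · rw [hq] at hRS hz0 hz1
    refine moebiusProd_ne hz0 hz1 squarefree_radical squarefree_radical (fun hr ↦ hmn ?_) hRS
    rw [← Nat.div_mul_cancel (radical_dvd_self (a := m)),
      ← Nat.div_mul_cancel (radical_dvd_self (a := n)), hq, hr]

lemma dvd_twelve_of_totient_eq_two (h : m.totient = 2) : m ∣ 12 := by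
  refine (Nat.dvd_iff_prime_pow_dvd_dvd 12 m).2 fun p k hp hpk ↦ ?_
  rcases Nat.eq_zero_or_pos k with rfl | hk
  · simp
  have hd := Nat.totient_dvd_of_dvd hpk
  rw [h, Nat.totient_prime_pow hp hk] at hd
  have hp3 : p ≤ 3 := by
    have := Nat.le_of_dvd two_pos ((Dvd.intro_left _ rfl).trans hd)
    omega
  have hk2 : p ^ (k - 1) ≤ 2 := Nat.le_of_dvd two_pos ((Dvd.intro _ rfl).trans hd)
  have hk3 : k - 1 < p ^ (k - 1) := Nat.lt_pow_self hp.one_lt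
  have hp2 := hp.two_le
  have hk4 : k ≤ 2 := by omega
  interval_cases p <;> interval_cases k <;> simp_all

lemma eq_of_totient_eq_two (h : m.totient = 2) : m = 3 ∨ m = 4 ∨ m = 6 := by
  have h12 := dvd_twelve_of_totient_eq_two h
  have := Nat.le_of_dvd (by norm_num) h12
  interval_cases m <;> revert h h12 <;> decide

lemma eval_cyclotomic_eq (hx : 2 ≤ x) (n : ℕ) :
    (cyclotomic n ℝ).eval x = normalizedCyclotomic n x * x ^ n.totient := by
  have : x ^ n.totient ≠ 0 := by positivity
  rw [normalizedCyclotomic, div_mul_cancel₀ _ this]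

lemma eval_cyclotomic_lt_of_totient_lt (hx : 2 ≤ x) (hm : 3 ≤ m) (hn : 3 ≤ n)
    (hlt : m.totient < n.totient) : (cyclotomic m ℝ).eval x < (cyclotomic n ℝ).eval x := by
  rw [eval_cyclotomic_eq hx, eval_cyclotomic_eq hx]
  obtain ⟨a, ha⟩ := Nat.totient_even (n := m) (by omega)
  obtain ⟨b, hb⟩ := Nat.totient_even (n := n) (by omega)
  have hA := (normalizedCyclotomic_mem_Ioo hx (n := m) (by omega)).2
  have hB := (normalizedCyclotomic_mem_Ioo hx (n := n) (by omega)).1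
  have hpow : x ^ (m.totient + 2) ≤ x ^ n.totient :=
    pow_le_pow_right₀ (by linarith) (by omega)
  have hp : 0 < x ^ m.totient := by positivity
  calc normalizedCyclotomic m x * x ^ m.totient < 2 * x ^ m.totient := by gcongr
    _ ≤ 1 / 2 * x ^ (m.totient + 2) := by
      have : 4 ≤ x ^ 2 := by nlinarith
      rw [pow_add]; nlinarith
    _ ≤ 1 / 2 * x ^ n.totient := by gcongr
    _ < _ := by gcongr

lemma eval_cyclotomic_ne (hx : 2 ≤ x) (hm : 3 ≤ m) (hn : 3 ≤ n) (hmn : m ≠ n) :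
    (cyclotomic m ℝ).eval x ≠ (cyclotomic n ℝ).eval x := by
  rcases lt_trichotomy m.totient n.totient with h | h | h
  · exact (eval_cyclotomic_lt_of_totient_lt hx hm hn h).ne
  · rw [eval_cyclotomic_eq hx, eval_cyclotomic_eq hx, h]
    have : x ^ n.totient ≠ 0 := by positivity
    exact fun h' ↦ normalizedCyclotomic_ne hx (by omega) (by omega) hmn (mul_right_cancel₀ this h')
  · exact (eval_cyclotomic_lt_of_totient_lt hx hn hm h).ne'

lemma eval_cyclotomic_one_lt (hx : 2 ≤ x) (hn : 2 ≤ n) :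
    (cyclotomic 1 ℝ).eval x < (cyclotomic n ℝ).eval x := by
  have h := sub_one_pow_totient_lt_cyclotomic_eval hn (show 1 < x by linarith)
  have h1 : (x - 1) ^ 1 ≤ (x - 1) ^ n.totient :=
    pow_le_pow_right₀ (by linarith) (Nat.totient_pos.2 (by omega))
  simp only [cyclotomic_one, eval_sub, eval_X, eval_one]
  linarith

lemma eq_of_eval_cyclotomic_two_eq (hx : 2 ≤ x) (hn : 3 ≤ n)
    (h : (cyclotomic 2 ℝ).eval x = (cyclotomic n ℝ).eval x) : x = 2 ∧ n = 6 := by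
  have h2 : (cyclotomic 2 ℝ).eval x = x + 1 := by simp [cyclotomic_two]
  obtain ⟨a, ha⟩ := Nat.totient_even (n := n) (by omega)
  have hpos : 0 < n.totient := Nat.totient_pos.2 (by omega)
  rw [h2] at h
  rcases (show a = 1 ∨ 2 ≤ a by omega) with rfl | ha2
  · rcases eq_of_totient_eq_two ha with rfl | rfl | rfl
    · rw [cyclotomic_three] at h
      simp at h
      nlinarith
    · have h4 : cyclotomic 4 ℝ = X ^ 2 + 1 := by
        rw [show 4 = 2 * 2 from rfl, ← cyclotomic_expand_eq_cyclotomic Nat.prime_two dvd_rfl]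
        simp
      rw [h4] at h
      simp at h
      nlinarith
    · have h6 : cyclotomic 6 ℝ = X ^ 2 - X + 1 := cyclotomic_six ℝ
      rw [h6] at h
      simp at h
      refine ⟨?_, rfl⟩
      have : x * (x - 2) = 0 := by linarith
      rcases mul_eq_zero.1 this with h' | h' <;> linarith
  · rw [eval_cyclotomic_eq hx] at h
    have hB := (normalizedCyclotomic_mem_Ioo hx (n := n) (by omega)).1
    have hpow : x ^ 4 ≤ x ^ n.totient := pow_le_pow_right₀ (by linarith) (by omega)
    have h4 : 8 * x ≤ x ^ 4 := by
      have : 2 ^ 3 ≤ x ^ 3 := by gcongr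
      nlinarith
    nlinarith

end Cyclotomic

end CyclotomicValues

theorem cyclotomic_ne_large_real (x : ℝ) (hx : 2 ≤ x) (m n : ℕ) (hm : 0 < m) (hn : 0 < n)
    (hmn : m ≠ n)
    (h : (Polynomial.cyclotomic m ℝ).eval x = (Polynomial.cyclotomic n ℝ).eval x) :
    x = 2 ∧ ({m, n} : Set ℕ) = {2, 6} := by
  wlog hlt : m < n generalizing m n
  · rw [Set.pair_comm]
    exact this n m hn hm hmn.symm h.symm (by omega)
  rcases (show m = 1 ∨ m = 2 ∨ 3 ≤ m by omega) with rfl | rfl | hm3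
  · exact absurd h (CyclotomicValues.eval_cyclotomic_one_lt hx hlt).ne
  · obtain ⟨hx2, rfl⟩ := CyclotomicValues.eq_of_eval_cyclotomic_two_eq hx hlt h
    exact ⟨hx2, rfl⟩
  · exact absurd h (CyclotomicValues.eval_cyclotomic_ne hx hm3 (by omega) hmn)
end
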